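/- Let G = (V_f, V_m, E) be a finite bipartite graph whose fixed vertices lie on a horizontal line ℓ in order p_1, …, p_r. Let G' be the graph obtained from G by adding a cycle through the fixed vertices in this linear order (edges (p_i, p_{i+1}) for 1 ≤ i < r and (p_r, p_1)). If G' is planar (as an abstract graph), then there exists an assignment σ : V_m → {above, below} such that for any two mobile vertices w ≠ w' with σ(w) = σ(w'), the neighbor index sets of w and w' along p_1, …, p_r do not interleave. -/

import Mathlib

open SimpleGraph

/-- `G` contains a subdivision of `H`: an injection of branch vertices together with
internally disjoint paths of `G` realizing the edges of `H`, whose internal vertices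
avoid all branch vertices. -/
structure GraphSubdivision {V W : Type*} (G : SimpleGraph V) (H : SimpleGraph W) where
  f : W ↪ V
  path : ∀ a b : W, H.Adj a b → G.Walk (f a) (f b)
  isPath : ∀ a b (h : H.Adj a b), (path a b h).IsPath
  internal_avoid : ∀ a b (h : H.Adj a b) (c : W), f c ∈ (path a b h).support → c = a ∨ c = b
  disjoint : ∀ a b (h : H.Adj a b) (a' b' : W) (h' : H.Adj a' b'),
    s(a, b) ≠ s(a', b') → ∀ x, x ∈ (path a b h).support → x ∈ (path a' b' h').support →
      (x = f a ∨ x = f b) ∧ (x = f a' ∨ x = f b')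

/-- Kuratowski planarity: no subdivision of `K₅` and no subdivision of `K_{3,3}`. -/
def KuratowskiPlanar {V : Type*} (G : SimpleGraph V) : Prop :=
  IsEmpty (GraphSubdivision G (⊤ : SimpleGraph (Fin 5))) ∧
  IsEmpty (GraphSubdivision G (completeBipartiteGraph (Fin 3) (Fin 3)))

/-- The augmented graph `G'`: the bipartite graph given by `adj` (between the fixed
vertices `Fin r` and the mobile vertices `Vm`) together with a cycle through the
fixed vertices in their linear order. -/
def augmentedGraph {Vm : Type*} (r : ℕ) (adj : Fin r → Vm → Prop) :
    SimpleGraph (Fin r ⊕ Vm) :=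
  SimpleGraph.fromRel (fun x y =>
    match x, y with
    | Sum.inl i, Sum.inl j => j.val = (i.val + 1) % r
    | Sum.inl i, Sum.inr w => adj i w
    | _, _ => False)

/-- Two index sets `I, J ⊆ Fin r` interleave. -/
def Interleaves {r : ℕ} (I J : Set (Fin r)) : Prop :=
  ∃ i₁ j₁ i₂ j₂ : Fin r, i₁ < j₁ ∧ j₁ < i₂ ∧ i₂ < j₂ ∧
    i₁ ∈ I ∧ i₂ ∈ I ∧ j₁ ∈ J ∧ j₂ ∈ J

/-- `u` and `v` are joined by a walk of `G` all of whose vertices satisfy `Q`. -/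
def ReachIn {V : Type*} (G : SimpleGraph V) (Q : V → Prop) (u v : V) : Prop :=
  ∃ p : G.Walk u v, ∀ x ∈ p.support, Q x

namespace ReachIn

variable {V : Type*} {G : SimpleGraph V} {Q : V → Prop} {u v w : V}

theorem refl (h : Q u) : ReachIn G Q u u :=
  ⟨.nil, by simpa using h⟩

theorem symm (h : ReachIn G Q u v) : ReachIn G Q v u := by
  obtain ⟨p, hp⟩ := h
  exact ⟨p.reverse, by simpa using hp⟩

theorem trans (h : ReachIn G Q u v) (h' : ReachIn G Q v w) : ReachIn G Q u w := by
  obtain ⟨p, hp⟩ := h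
  obtain ⟨q, hq⟩ := h'
  refine ⟨p.append q, fun x hx => ?_⟩
  rcases (Walk.mem_support_append_iff _ _).1 hx with h | h
  exacts [hp x h, hq x h]

theorem of_adj (h : G.Adj u v) (hu : Q u) (hv : Q v) : ReachIn G Q u v :=
  ⟨h.toWalk, by simp [hu, hv]⟩

theorem mono {Q' : V → Prop} (h : ReachIn G Q u v) (hQ : ∀ x, Q x → Q' x) :
    ReachIn G Q' u v := by
  obtain ⟨p, hp⟩ := h
  exact ⟨p, fun x hx => hQ x (hp x hx)⟩

theorem exists_path (h : ReachIn G Q u v) :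
    ∃ p : G.Walk u v, p.IsPath ∧ ∀ x ∈ p.support, Q x := by
  classical
  obtain ⟨p, hp⟩ := h
  exact ⟨p.bypass, p.bypass_isPath, fun x hx => hp x (p.support_bypass_subset_support hx)⟩

end ReachIn

/-- A labelling of the vertices of `G` by vertices and edges of `H` produces a subdivision of `H`
as soon as each edge of `H` is realized by a walk through vertices with the right labels. -/
theorem GraphSubdivision.nonempty_of_label {V W γ : Type*} {G : SimpleGraph V}
    {H : SimpleGraph W} (f : W → V) (lab : V → γ) (cv : W → γ) (ce : W → W → γ)
    (hf : ∀ a x, lab x = cv a ↔ x = f a) (hcv : Function.Injective cv)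
    (hve : ∀ a b c, H.Adj a b → ce a b ≠ cv c)
    (hee : ∀ a b a' b', H.Adj a b → H.Adj a' b' → ce a b = ce a' b' → s(a, b) = s(a', b'))
    (hp : ∀ a b, H.Adj a b →
      ReachIn G (fun x => lab x = cv a ∨ lab x = cv b ∨ lab x = ce a b) (f a) (f b)) :
    Nonempty (GraphSubdivision G H) := by
  have hlab : ∀ a, lab (f a) = cv a := fun a => (hf a _).2 rfl
  choose p hpath hsupp using fun a b h => (hp a b h).exists_path
  refine ⟨⟨⟨f, fun a b hab => hcv ?_⟩, p, hpath, ?_, ?_⟩⟩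
  · rw [← hlab, ← hlab, hab]
  · intro a b h c hc
    rcases hsupp a b h _ hc with h1 | h1 | h1
    · exact .inl (hcv ((hlab c).symm.trans h1))
    · exact .inr (hcv ((hlab c).symm.trans h1))
    · exact absurd (h1.symm.trans (hlab c)) (hve a b c h)
  · intro a b h a' b' h' hne x hx hx'
    have h1 := hsupp a b h x hx
    have h2 := hsupp a' b' h' x hx'
    rcases h1 with h1 | h1 | h1
    · refine ⟨.inl ((hf _ _).1 h1), ?_⟩
      rcases h2 with h2 | h2 | h2
      · exact .inl ((hf _ _).1 h2)
      · exact .inr ((hf _ _).1 h2)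
      · exact absurd (h2.symm.trans h1) (hve _ _ _ h')
    · refine ⟨.inr ((hf _ _).1 h1), ?_⟩
      rcases h2 with h2 | h2 | h2
      · exact .inl ((hf _ _).1 h2)
      · exact .inr ((hf _ _).1 h2)
      · exact absurd (h2.symm.trans h1) (hve _ _ _ h')
    · rcases h2 with h2 | h2 | h2
      · exact absurd (h1.symm.trans h2) (hve _ _ _ h)
      · exact absurd (h1.symm.trans h2) (hve _ _ _ h)
      · exact absurd (hee _ _ _ _ h h' (h1.symm.trans h2)) hne

/-- Criterion for containing a subdivided `K₃,₃`: branch vertices `A i` and `B j` carry the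
labels `4 * i + 3` and `12 + j`, inner vertices of the path joining them the label `4 * i + j`. -/
theorem KuratowskiPlanar.false_of_label_bipartite {V : Type*} {G : SimpleGraph V}
    (hG : KuratowskiPlanar G) (lab : V → ℕ) (A B : Fin 3 → V)
    (hA : ∀ i x, lab x = 4 * i.val + 3 ↔ x = A i) (hB : ∀ j x, lab x = 12 + j.val ↔ x = B j)
    (hp : ∀ i j, ReachIn G
      (fun x => lab x = 4 * i.val + 3 ∨ lab x = 12 + j.val ∨ lab x = 4 * i.val + j.val)
      (A i) (B j)) : False := by
  refine hG.2.elim' (Classical.choice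
    (GraphSubdivision.nonempty_of_label (Sum.elim A B) lab
      (Sum.elim (fun i => 4 * i.val + 3) (fun j => 12 + j.val))
      (fun a b => match a, b with
        | .inl i, .inr j => 4 * i.val + j.val
        | .inr j, .inl i => 4 * i.val + j.val
        | _, _ => 15) ?_ ?_ ?_ ?_ ?_))
  · rintro (i | j) x
    exacts [hA i x, hB j x]
  · decide
  · rintro (a | a) (b | b) (c | c) h <;> simp at h ⊢ <;> omega
  · rintro (a | a) (b | b) (c | c) (d | d) h h' <;> simp [Fin.ext_iff] at h h' ⊢ <;> omega
  · rintro (a | a) (b | b) h <;> simp at h ⊢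
    · exact hp a b
    · exact (hp b a).symm.mono fun x hx => by tauto

/-- Criterion for containing a subdivided `K₅`: the branch vertex `f a` carries the label `a`,
inner vertices of the path joining `f a` and `f b` with `a < b` the label `5 + 5 * a + b`. -/
theorem KuratowskiPlanar.false_of_label_complete {V : Type*} {G : SimpleGraph V}
    (hG : KuratowskiPlanar G) (lab : V → ℕ) (f : Fin 5 → V)
    (hf : ∀ a x, lab x = a.val ↔ x = f a)
    (hp : ∀ a b, a < b → ReachIn G
      (fun x => lab x = a.val ∨ lab x = b.val ∨ lab x = 5 + 5 * a.val + b.val)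
      (f a) (f b)) : False := by
  refine hG.1.elim' (Classical.choice
    (GraphSubdivision.nonempty_of_label f lab (fun a => a.val)
      (fun a b => 5 + 5 * (min a b).val + (max a b).val) hf Fin.val_injective ?_ ?_ ?_))
  · intro a b c h
    omega
  · decide
  · intro a b h
    rcases lt_or_gt_of_ne h.ne with hab | hab
    · simpa [min_eq_left hab.le, max_eq_right hab.le] using hp a b hab
    · simpa [min_eq_right hab.le, max_eq_left hab.le, or_left_comm] using (hp b a hab).symm

section AugmentedGraph

variable {Vm : Type*} {r : ℕ} {adj : Fin r → Vm → Prop}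

theorem augmentedGraph_adj_inr {i : Fin r} {w : Vm} (h : adj i w) :
    (augmentedGraph r adj).Adj (.inl i) (.inr w) := by
  simp [augmentedGraph, h]

theorem augmentedGraph_adj_inl {i j : Fin r} (hr : 3 ≤ r) (h : j.val = (i.val + 1) % r) :
    (augmentedGraph r adj).Adj (.inl i) (.inl j) := by
  refine (fromRel_adj _ _ _).2 ⟨fun hij => ?_, .inl h⟩
  rw [Sum.inl.inj hij] at h
  have := j.isLt
  rcases Nat.lt_or_ge (j.val + 1) r with h1 | h1
  · rw [Nat.mod_eq_of_lt h1] at h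
    omega
  · rw [show j.val + 1 = r by omega, Nat.mod_self] at h
    omega

theorem reachIn_chord {Q : Fin r ⊕ Vm → Prop} {i j : Fin r} {w : Vm} (hi : adj i w)
    (hj : adj j w) (Qi : Q (.inl i)) (Qj : Q (.inl j)) (Qw : Q (.inr w)) :
    ReachIn (augmentedGraph r adj) Q (.inl i) (.inl j) :=
  (ReachIn.of_adj (augmentedGraph_adj_inr hi) Qi Qw).trans
    (ReachIn.of_adj (augmentedGraph_adj_inr hj) Qj Qw).symm

theorem reachIn_arc (hr : 3 ≤ r) {Q : Fin r ⊕ Vm → Prop} {i j : Fin r} (hij : i ≤ j)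
    (hQ : ∀ k, i ≤ k → k ≤ j → Q (.inl k)) :
    ReachIn (augmentedGraph r adj) Q (.inl i) (.inl j) := by
  obtain ⟨j, hj⟩ := j
  induction j with
  | zero =>
    obtain rfl : i = ⟨0, hj⟩ := le_antisymm hij (Nat.zero_le _)
    exact .refl (hQ _ le_rfl le_rfl)
  | succ j ih =>
    rcases hij.eq_or_lt with rfl | hlt
    · exact .refl (hQ _ le_rfl le_rfl)
    · have hi : i ≤ ⟨j, by omega⟩ := Nat.le_of_lt_succ hlt
      have hjj : (⟨j, by omega⟩ : Fin r) ≤ ⟨j + 1, hj⟩ := Nat.le_succ j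
      refine (ih (by omega) hi fun k hk hk' => hQ k hk (hk'.trans hjj)).trans
        (.of_adj (augmentedGraph_adj_inl hr ?_) (hQ _ hi hjj) (hQ _ hij le_rfl))
      simp [Nat.mod_eq_of_lt hj]

theorem reachIn_wrap (hr : 3 ≤ r) {Q : Fin r ⊕ Vm → Prop} {i j : Fin r} (hj : j.val = 0)
    (hQ : ∀ k, i ≤ k → Q (.inl k)) (hQj : Q (.inl j)) :
    ReachIn (augmentedGraph r adj) Q (.inl i) (.inl j) := by
  have hi : i ≤ (⟨r - 1, by omega⟩ : Fin r) := by
    have := i.isLt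
    exact Fin.mk_le_mk.2 (by omega)
  refine (reachIn_arc hr hi fun k hk _ => hQ k hk).trans
    (.of_adj (augmentedGraph_adj_inl hr ?_) (hQ _ hi) hQj)
  simp [hj, show r - 1 + 1 = r by omega]

end AugmentedGraph

section Configurations

variable {Vm : Type*} {r : ℕ} {adj : Fin r → Vm → Prop}

open Classical in
theorem KuratowskiPlanar.false_of_three_chords (hr : 3 ≤ r)
    (hG : KuratowskiPlanar (augmentedGraph r adj)) {a b c d e f : Fin r} {X Y Z : Vm}
    (h₀ : a.val = 0) (hab : a < b) (hbc : b < c) (hcd : c < d) (hde : d < e) (hef : e < f)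
    (hXY : X ≠ Y) (hXZ : X ≠ Z) (hYZ : Y ≠ Z)
    (hXa : adj a X) (hXd : adj d X) (hYb : adj b Y) (hYe : adj e Y) (hZc : adj c Z)
    (hZf : adj f Z) :
    False := by
  set lab : Fin r ⊕ Vm → ℕ := Sum.elim
    (fun k => if k = a then 3 else if k < b then 0 else if k = b then 12 else if k < c then 4 else
      if k = c then 7 else if k < d then 5 else if k = d then 13 else if k < e then 9 else
      if k = e then 11 else if k < f then 10 else if k = f then 14 else 2)
    (fun w => if w = X then 1 else if w = Y then 8 else if w = Z then 6 else 15) with hlab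
  refine hG.false_of_label_bipartite lab ![.inl a, .inl c, .inl e] ![.inl b, .inl d, .inl f] ?_ ?_
      ?_
  · intro i x
    fin_cases i <;> rcases x with k | w <;> simp [lab] <;> grind (splits := 30)
  · intro i x
    fin_cases i <;> rcases x with k | w <;> simp [lab] <;> grind (splits := 30)
  · intro i j
    fin_cases i <;> fin_cases j
    · refine reachIn_arc hr (i := a) (j := b) ?_ ?_ <;> grind (splits := 30)
    · refine reachIn_chord (i := a) (j := d) (w := X) ‹_› ‹_› ?_ ?_ ?_ <;> grind (splits := 30)
    · refine (reachIn_wrap hr (i := f) (j := a) h₀ ?_ ?_).symm <;> grind (splits := 30)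
    · refine (reachIn_arc hr (i := b) (j := c) ?_ ?_).symm <;> grind (splits := 30)
    · refine reachIn_arc hr (i := c) (j := d) ?_ ?_ <;> grind (splits := 30)
    · refine reachIn_chord (i := c) (j := f) (w := Z) ‹_› ‹_› ?_ ?_ ?_ <;> grind (splits := 30)
    · refine reachIn_chord (i := e) (j := b) (w := Y) ‹_› ‹_› ?_ ?_ ?_ <;> grind (splits := 30)
    · refine (reachIn_arc hr (i := d) (j := e) ?_ ?_).symm <;> grind (splits := 30)
    · refine reachIn_arc hr (i := e) (j := f) ?_ ?_ <;> grind (splits := 30)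

open Classical in
theorem KuratowskiPlanar.false_of_tripod_two_corners (hr : 3 ≤ r)
    (hG : KuratowskiPlanar (augmentedGraph r adj)) {y p z s t : Fin r} {X Y Z : Vm}
    (h₀ : y.val = 0) (hyp : y < p) (hpz : p < z) (hzs : z < s) (hst : s < t)
    (hXY : X ≠ Y) (hXZ : X ≠ Z) (hYZ : Y ≠ Z)
    (hXp : adj p X) (hXs : adj s X) (hXt : adj t X) (hYy : adj y Y) (hYs : adj s Y) (hZz : adj z Z)
    (hZt : adj t Z) :
    False := by
  set lab : Fin r ⊕ Vm → ℕ := Sum.elim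
    (fun k => if k = y then 7 else if k < p then 4 else if k = p then 12 else if k < z then 8 else
      if k = z then 11 else if k < s then 9 else if k = s then 13 else if k < t then 15 else
      if k = t then 14 else 6)
    (fun w => if w = X then 3 else if w = Y then 5 else if w = Z then 10 else 15) with hlab
  refine hG.false_of_label_bipartite lab ![.inr X, .inl y, .inl z] ![.inl p, .inl s, .inl t] ?_ ?_
      ?_
  · intro i x
    fin_cases i <;> rcases x with k | w <;> simp [lab] <;> grind (splits := 30)
  · intro i x
    fin_cases i <;> rcases x with k | w <;> simp [lab] <;> grind (splits := 30)
  · intro i j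
    fin_cases i <;> fin_cases j
    · refine (ReachIn.of_adj (augmentedGraph_adj_inr (i := p) (w := X) ‹_›) ?_ ?_).symm <;> grind
        (splits := 30)
    · refine (ReachIn.of_adj (augmentedGraph_adj_inr (i := s) (w := X) ‹_›) ?_ ?_).symm <;> grind
        (splits := 30)
    · refine (ReachIn.of_adj (augmentedGraph_adj_inr (i := t) (w := X) ‹_›) ?_ ?_).symm <;> grind
        (splits := 30)
    · refine reachIn_arc hr (i := y) (j := p) ?_ ?_ <;> grind (splits := 30)
    · refine reachIn_chord (i := y) (j := s) (w := Y) ‹_› ‹_› ?_ ?_ ?_ <;> grind (splits := 30)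
    · refine (reachIn_wrap hr (i := t) (j := y) h₀ ?_ ?_).symm <;> grind (splits := 30)
    · refine (reachIn_arc hr (i := p) (j := z) ?_ ?_).symm <;> grind (splits := 30)
    · refine reachIn_arc hr (i := z) (j := s) ?_ ?_ <;> grind (splits := 30)
    · refine reachIn_chord (i := z) (j := t) (w := Z) ‹_› ‹_› ?_ ?_ ?_ <;> grind (splits := 30)

open Classical in
theorem KuratowskiPlanar.false_of_tripod_last_corner (hr : 3 ≤ r)
    (hG : KuratowskiPlanar (augmentedGraph r adj)) {y p z s c t : Fin r} {X Y Z : Vm}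
    (h₀ : y.val = 0) (hyp : y < p) (hpz : p < z) (hzs : z < s) (hsc : s < c) (hct : c < t)
    (hXY : X ≠ Y) (hXZ : X ≠ Z) (hYZ : Y ≠ Z)
    (hXp : adj p X) (hXs : adj s X) (hXt : adj t X) (hYy : adj y Y) (hYc : adj c Y) (hZz : adj z Z)
    (hZt : adj t Z) :
    False := by
  set lab : Fin r ⊕ Vm → ℕ := Sum.elim
    (fun k => if k = y then 11 else if k < p then 8 else if k = p then 12 else if k < z then 4 else
      if k = z then 7 else if k < s then 5 else if k = s then 13 else if k ≤ c then 9 else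
      if k < t then 15 else if k = t then 14 else 10)
    (fun w => if w = X then 3 else if w = Y then 9 else if w = Z then 6 else 15) with hlab
  refine hG.false_of_label_bipartite lab ![.inr X, .inl z, .inl y] ![.inl p, .inl s, .inl t] ?_ ?_
      ?_
  · intro i x
    fin_cases i <;> rcases x with k | w <;> simp [lab] <;> grind (splits := 30)
  · intro i x
    fin_cases i <;> rcases x with k | w <;> simp [lab] <;> grind (splits := 30)
  · intro i j
    fin_cases i <;> fin_cases j
    · refine (ReachIn.of_adj (augmentedGraph_adj_inr (i := p) (w := X) ‹_›) ?_ ?_).symm <;> grind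
        (splits := 30)
    · refine (ReachIn.of_adj (augmentedGraph_adj_inr (i := s) (w := X) ‹_›) ?_ ?_).symm <;> grind
        (splits := 30)
    · refine (ReachIn.of_adj (augmentedGraph_adj_inr (i := t) (w := X) ‹_›) ?_ ?_).symm <;> grind
        (splits := 30)
    · refine (reachIn_arc hr (i := p) (j := z) ?_ ?_).symm <;> grind (splits := 30)
    · refine reachIn_arc hr (i := z) (j := s) ?_ ?_ <;> grind (splits := 30)
    · refine reachIn_chord (i := z) (j := t) (w := Z) ‹_› ‹_› ?_ ?_ ?_ <;> grind (splits := 30)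
    · refine reachIn_arc hr (i := y) (j := p) ?_ ?_ <;> grind (splits := 30)
    · refine (reachIn_chord (i := y) (j := c) (w := Y) ‹_› ‹_› ?_ ?_ ?_).trans
        (reachIn_arc hr (i := s) (j := c) ?_ ?_).symm <;> grind (splits := 30)
    · refine (reachIn_wrap hr (i := t) (j := y) h₀ ?_ ?_).symm <;> grind (splits := 30)

open Classical in
theorem KuratowskiPlanar.false_of_tripod_middle_corner (hr : 3 ≤ r)
    (hG : KuratowskiPlanar (augmentedGraph r adj)) {y p z c t q : Fin r} {X Y Z : Vm}
    (h₀ : y.val = 0) (hyp : y < p) (hpz : p < z) (hzc : z < c) (hct : c < t) (htq : t < q)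
    (hXY : X ≠ Y) (hXZ : X ≠ Z) (hYZ : Y ≠ Z)
    (hXp : adj p X) (hXc : adj c X) (hXq : adj q X) (hYy : adj y Y) (hYc : adj c Y) (hZz : adj z Z)
    (hZt : adj t Z) :
    False := by
  set lab : Fin r ⊕ Vm → ℕ := Sum.elim
    (fun k => if k = y then 7 else if k < p then 5 else if k = p then 13 else if k ≤ z then 9 else
      if k < c then 15 else if k = c then 14 else if k < t then 10 else if k = t then 11 else
      if k < q then 8 else if k = q then 12 else 4)
    (fun w => if w = X then 3 else if w = Y then 6 else if w = Z then 9 else 15) with hlab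
  refine hG.false_of_label_bipartite lab ![.inr X, .inl y, .inl t] ![.inl q, .inl p, .inl c] ?_ ?_
      ?_
  · intro i x
    fin_cases i <;> rcases x with k | w <;> simp [lab] <;> grind (splits := 30)
  · intro i x
    fin_cases i <;> rcases x with k | w <;> simp [lab] <;> grind (splits := 30)
  · intro i j
    fin_cases i <;> fin_cases j
    · refine (ReachIn.of_adj (augmentedGraph_adj_inr (i := q) (w := X) ‹_›) ?_ ?_).symm <;> grind
        (splits := 30)
    · refine (ReachIn.of_adj (augmentedGraph_adj_inr (i := p) (w := X) ‹_›) ?_ ?_).symm <;> grind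
        (splits := 30)
    · refine (ReachIn.of_adj (augmentedGraph_adj_inr (i := c) (w := X) ‹_›) ?_ ?_).symm <;> grind
        (splits := 30)
    · refine (reachIn_wrap hr (i := q) (j := y) h₀ ?_ ?_).symm <;> grind (splits := 30)
    · refine reachIn_arc hr (i := y) (j := p) ?_ ?_ <;> grind (splits := 30)
    · refine reachIn_chord (i := y) (j := c) (w := Y) ‹_› ‹_› ?_ ?_ ?_ <;> grind (splits := 30)
    · refine reachIn_arc hr (i := t) (j := q) ?_ ?_ <;> grind (splits := 30)
    · refine (reachIn_chord (i := t) (j := z) (w := Z) ‹_› ‹_› ?_ ?_ ?_).trans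
        (reachIn_arc hr (i := p) (j := z) ?_ ?_).symm <;> grind (splits := 30)
    · refine (reachIn_arc hr (i := c) (j := t) ?_ ?_).symm <;> grind (splits := 30)

open Classical in
theorem KuratowskiPlanar.false_of_four_corners (hr : 3 ≤ r)
    (hG : KuratowskiPlanar (augmentedGraph r adj)) {a b c d : Fin r} {X Y Z : Vm}
    (h₀ : a.val = 0) (hab : a < b) (hbc : b < c) (hcd : c < d)
    (hXY : X ≠ Y) (hXZ : X ≠ Z) (hYZ : Y ≠ Z)
    (hXa : adj a X) (hXb : adj b X) (hXc : adj c X) (hXd : adj d X) (hYa : adj a Y) (hYc : adj c Y)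
    (hZb : adj b Z) (hZd : adj d Z) :
    False := by
  set lab : Fin r ⊕ Vm → ℕ := Sum.elim
    (fun k => if k = a then 1 else if k < b then 12 else if k = b then 2 else if k < c then 18 else
      if k = c then 3 else if k < d then 24 else if k = d then 4 else 14)
    (fun w => if w = X then 0 else if w = Y then 13 else if w = Z then 19 else 100) with hlab
  refine hG.false_of_label_complete lab ![.inr X, .inl a, .inl b, .inl c, .inl d] ?_ ?_
  · intro i x
    fin_cases i <;> rcases x with k | w <;> simp [lab] <;> grind (splits := 30)
  · intro i j hij
    fin_cases i <;> fin_cases j <;> first | exact absurd hij (by decide) | skip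
    · refine (ReachIn.of_adj (augmentedGraph_adj_inr (i := a) (w := X) ‹_›) ?_ ?_).symm <;> grind
        (splits := 30)
    · refine (ReachIn.of_adj (augmentedGraph_adj_inr (i := b) (w := X) ‹_›) ?_ ?_).symm <;> grind
        (splits := 30)
    · refine (ReachIn.of_adj (augmentedGraph_adj_inr (i := c) (w := X) ‹_›) ?_ ?_).symm <;> grind
        (splits := 30)
    · refine (ReachIn.of_adj (augmentedGraph_adj_inr (i := d) (w := X) ‹_›) ?_ ?_).symm <;> grind
        (splits := 30)
    · refine reachIn_arc hr (i := a) (j := b) ?_ ?_ <;> grind (splits := 30)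
    · refine reachIn_chord (i := a) (j := c) (w := Y) ‹_› ‹_› ?_ ?_ ?_ <;> grind (splits := 30)
    · refine (reachIn_wrap hr (i := d) (j := a) h₀ ?_ ?_).symm <;> grind (splits := 30)
    · refine reachIn_arc hr (i := b) (j := c) ?_ ?_ <;> grind (splits := 30)
    · refine reachIn_chord (i := b) (j := d) (w := Z) ‹_› ‹_› ?_ ?_ ?_ <;> grind (splits := 30)
    · refine reachIn_arc hr (i := c) (j := d) ?_ ?_ <;> grind (splits := 30)

open Classical in
theorem KuratowskiPlanar.false_of_pentagram (hr : 3 ≤ r)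
    (hG : KuratowskiPlanar (augmentedGraph r adj)) {a b c d e : Fin r} {v₀ v₁ v₂ v₃ v₄ : Vm}
    (h₀ : a.val = 0) (hab : a < b) (hbc : b < c) (hcd : c < d) (hde : d < e)
    (hv₀v₁ : v₀ ≠ v₁) (hv₀v₂ : v₀ ≠ v₂) (hv₀v₃ : v₀ ≠ v₃) (hv₀v₄ : v₀ ≠ v₄) (hv₁v₂ : v₁ ≠ v₂)
    (hv₁v₃ : v₁ ≠ v₃) (hv₁v₄ : v₁ ≠ v₄) (hv₂v₃ : v₂ ≠ v₃) (hv₂v₄ : v₂ ≠ v₄) (hv₃v₄ : v₃ ≠ v₄)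
    (hv₀a : adj a v₀) (hv₀c : adj c v₀) (hv₁b : adj b v₁) (hv₁d : adj d v₁) (hv₂c : adj c v₂)
    (hv₂e : adj e v₂) (hv₃d : adj d v₃) (hv₃a : adj a v₃) (hv₄e : adj e v₄) (hv₄b : adj b v₄) :
    False := by
  set lab : Fin r ⊕ Vm → ℕ := Sum.elim
    (fun k => if k = a then 0 else if k < b then 6 else if k = b then 1 else if k < c then 12 else
      if k = c then 2 else if k < d then 18 else if k = d then 3 else if k < e then 24 else
      if k = e then 4 else 9)
    (fun w => if w = v₀ then 7 else if w = v₁ then 13 else if w = v₂ then 19 else if w = v₃ then 8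
        else if w = v₄ then 14 else 100) with hlab
  refine hG.false_of_label_complete lab ![.inl a, .inl b, .inl c, .inl d, .inl e] ?_ ?_
  · intro i x
    fin_cases i <;> rcases x with k | w <;> simp [lab] <;> grind (splits := 30)
  · intro i j hij
    fin_cases i <;> fin_cases j <;> first | exact absurd hij (by decide) | skip
    · refine reachIn_arc hr (i := a) (j := b) ?_ ?_ <;> grind (splits := 30)
    · refine reachIn_chord (i := a) (j := c) (w := v₀) ‹_› ‹_› ?_ ?_ ?_ <;> grind (splits := 30)
    · refine reachIn_chord (i := a) (j := d) (w := v₃) ‹_› ‹_› ?_ ?_ ?_ <;> grind (splits := 30)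
    · refine (reachIn_wrap hr (i := e) (j := a) h₀ ?_ ?_).symm <;> grind (splits := 30)
    · refine reachIn_arc hr (i := b) (j := c) ?_ ?_ <;> grind (splits := 30)
    · refine reachIn_chord (i := b) (j := d) (w := v₁) ‹_› ‹_› ?_ ?_ ?_ <;> grind (splits := 30)
    · refine reachIn_chord (i := b) (j := e) (w := v₄) ‹_› ‹_› ?_ ?_ ?_ <;> grind (splits := 30)
    · refine reachIn_arc hr (i := c) (j := d) ?_ ?_ <;> grind (splits := 30)
    · refine reachIn_chord (i := c) (j := e) (w := v₂) ‹_› ‹_› ?_ ?_ ?_ <;> grind (splits := 30)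
    · refine reachIn_arc hr (i := d) (j := e) ?_ ?_ <;> grind (splits := 30)

end Configurations

/-- Kuratowski planarity is inherited along injective homomorphisms. -/
theorem KuratowskiPlanar.of_injective_hom {V V' : Type*} {G : SimpleGraph V}
    {G' : SimpleGraph V'} (hG : KuratowskiPlanar G') (φ : G →g G')
    (hφ : Function.Injective φ) : KuratowskiPlanar G := by
  have hs : ∀ {u v : V} (p : G.Walk u v) (x : V'), x ∈ (p.map φ).support →
      ∃ y ∈ p.support, φ y = x := fun p x hx => by
    rwa [Walk.support_map, List.mem_map] at hx
  have key : ∀ {W : Type} {H : SimpleGraph W}, GraphSubdivision G H →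
      Nonempty (GraphSubdivision G' H) := fun {W H} S =>
    ⟨{  f := S.f.trans ⟨φ, hφ⟩
        path := fun a b h => (S.path a b h).map φ
        isPath := fun a b h => (S.isPath a b h).map hφ
        internal_avoid := fun a b h c hc => by
          obtain ⟨x, hx, hxc⟩ := hs _ _ hc
          obtain rfl : x = S.f c := hφ hxc
          exact S.internal_avoid a b h c hx
        disjoint := fun a b h a' b' h' hne x hx hx' => by
          obtain ⟨y, hy, rfl⟩ := hs _ _ hx
          obtain ⟨z, hz, hzy⟩ := hs _ _ hx'
          obtain rfl : z = y := hφ hzy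
          have := S.disjoint a b h a' b' h' hne z hy hz
          exact ⟨this.1.imp (congrArg φ) (congrArg φ), this.2.imp (congrArg φ) (congrArg φ)⟩ }⟩
  exact ⟨⟨fun S => hG.1.elim' (key S).some⟩, ⟨fun S => hG.2.elim' (key S).some⟩⟩

section Rotation

variable {r : ℕ}

/-- Rotation of `Fin r` sending `0` to `k`. -/
def cycRot (k i : Fin r) : Fin r :=
  ⟨if i.val + k.val < r then i.val + k.val else i.val + k.val - r, by split <;> omega⟩

/-- Rotation of `Fin r` sending `k` to `0`. -/
def cycUnrot (k i : Fin r) : Fin r :=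
  ⟨if k.val ≤ i.val then i.val - k.val else i.val + r - k.val, by split <;> omega⟩

theorem cycRot_cycUnrot (k i : Fin r) : cycRot k (cycUnrot k i) = i := by
  apply Fin.ext
  simp only [cycRot, cycUnrot]
  split <;> split <;> omega

theorem cycRot_injective (k : Fin r) : Function.Injective (cycRot k) := by
  intro i j h
  have := Fin.ext_iff.1 h
  simp only [cycRot] at this
  apply Fin.ext
  split at this <;> split at this <;> omega

theorem succ_mod_eq {m : ℕ} (h : m < r) : (m + 1) % r = if m + 1 = r then 0 else m + 1 := by
  split
  · simp_all
  · exact Nat.mod_eq_of_lt (by omega)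

theorem KuratowskiPlanar.rotate {Vm : Type*} {adj : Fin r → Vm → Prop}
    (hG : KuratowskiPlanar (augmentedGraph r adj)) (k : Fin r) :
    KuratowskiPlanar (augmentedGraph r fun i w => adj (cycRot k i) w) := by
  have hinj : Function.Injective (Sum.map (cycRot k) id : Fin r ⊕ Vm → Fin r ⊕ Vm) :=
    Sum.map_injective.2 ⟨cycRot_injective k, Function.injective_id⟩
  have hrot : ∀ i j : Fin r, j.val = (i.val + 1) % r →
      (cycRot k j).val = ((cycRot k i).val + 1) % r := by
    intro i j h
    rw [succ_mod_eq i.isLt] at h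
    rw [succ_mod_eq (cycRot k i).isLt]
    simp only [cycRot]
    split_ifs at h ⊢ <;> omega
  refine hG.of_injective_hom ⟨Sum.map (cycRot k) id, ?_⟩ hinj
  intro x y h
  refine (fromRel_adj _ _ _).2 ⟨fun e => h.ne (hinj e), ?_⟩
  rcases ((fromRel_adj _ _ _).1 h).2 with hxy | hxy
  · left
    rcases x with i | w <;> rcases y with j | w'
    exacts [hrot _ _ hxy, hxy, hxy.elim, hxy.elim]
  · right
    rcases x with i | w <;> rcases y with j | w'
    exacts [hrot _ _ hxy, hxy.elim, hxy, hxy.elim]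

/-- The points `a`, `b`, `c` are distinct and in this cyclic order. -/
def CycLt (a b c : Fin r) : Prop :=
  a.val < b.val ∧ b.val < c.val ∨ b.val < c.val ∧ c.val < a.val ∨ c.val < a.val ∧ a.val < b.val

theorem CycLt.unrot {a b c : Fin r} (h : CycLt a b c) (k : Fin r) :
    CycLt (cycUnrot k a) (cycUnrot k b) (cycUnrot k c) := by
  simp only [CycLt, cycUnrot] at *
  split_ifs <;> omega

theorem CycLt.rotl {a b c : Fin r} (h : CycLt a b c) : CycLt b c a := by
  simp only [CycLt] at *
  omega

theorem CycLt.trans {a b c d : Fin r} (h : CycLt a b c) (h' : CycLt a c d) : CycLt a b d := by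
  simp only [CycLt] at *
  omega

theorem CycLt.split {a b m x : Fin r} (hx : CycLt a x b) (hm : CycLt a m b) (h : x ≠ m) :
    CycLt a x m ∨ CycLt m x b := by
  rw [ne_eq, Fin.ext_iff] at h
  simp only [CycLt] at *
  omega

theorem CycLt.total {a b x : Fin r} (hab : a ≠ b) (ha : x ≠ a) (hb : x ≠ b) :
    CycLt a x b ∨ CycLt b x a := by
  rw [ne_eq, Fin.ext_iff] at *
  simp only [CycLt] at *
  omega

theorem CycLt.eq_of_mem {a b m n x : Fin r} (hx : CycLt a x b) (hn : CycLt b n a)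
    (h : x = a ∨ x = m ∨ x = b ∨ x = n) : x = m := by
  rcases h with rfl | rfl | rfl | rfl <;> simp only [CycLt] at * <;> omega

/-- The chords `p q` and `a b` of the cycle cross. -/
def Crosses (p q a b : Fin r) : Prop :=
  CycLt a p b ∧ CycLt b q a ∨ CycLt a q b ∧ CycLt b p a

theorem Crosses.symm {p q a b : Fin r} (h : Crosses p q a b) : Crosses a b p q := by
  simp only [Crosses, CycLt] at *
  omega

theorem Crosses.swap_left {p q a b : Fin r} (h : Crosses p q a b) : Crosses q p a b := by
  simp only [Crosses, CycLt] at *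
  omega

theorem Crosses.swap_right {p q a b : Fin r} (h : Crosses p q a b) : Crosses p q b a := by
  simp only [Crosses, CycLt] at *
  omega

theorem Crosses.exists_separated {p q a b : Fin r} {S : Set (Fin r)} (h : Crosses p q a b)
    (hp : p ∈ S) (hq : q ∈ S) : ∃ x ∈ S, ∃ y ∈ S, CycLt a x b ∧ CycLt b y a := by
  rcases h with h | h
  exacts [⟨p, hp, q, hq, h⟩, ⟨q, hq, p, hp, h⟩]

/-- Some chord of `S` crosses some chord of `T`. -/
def Conflict (S T : Set (Fin r)) : Prop :=
  ∃ p ∈ S, ∃ q ∈ S, ∃ a ∈ T, ∃ b ∈ T, Crosses p q a b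

theorem Conflict.symm {S T : Set (Fin r)} (h : Conflict S T) : Conflict T S := by
  obtain ⟨p, hp, q, hq, a, ha, b, hb, h⟩ := h
  exact ⟨a, ha, b, hb, p, hp, q, hq, h.symm⟩

theorem Conflict.mono {S T S' T' : Set (Fin r)} (h : Conflict S T) (hS : S ⊆ S')
    (hT : T ⊆ T') : Conflict S' T' := by
  obtain ⟨p, hp, q, hq, a, ha, b, hb, h⟩ := h
  exact ⟨p, hS hp, q, hS hq, a, hT ha, b, hT hb, h⟩

theorem Interleaves.conflict {S T : Set (Fin r)} (h : Interleaves S T) : Conflict S T := by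
  obtain ⟨i₁, j₁, i₂, j₂, h₁, h₂, h₃, hi₁, hi₂, hj₁, hj₂⟩ := h
  refine ⟨i₁, hi₁, i₂, hi₂, j₁, hj₁, j₂, hj₂, ?_⟩
  simp only [Crosses, CycLt, Fin.lt_def] at *
  omega

/-- A set having chords across two noncrossing chords has a single chord across both. -/
theorem exists_crosses_both {S : Set (Fin r)} {p q p' q' a b c d : Fin r} (hp : p ∈ S)
    (hq : q ∈ S) (hp' : p' ∈ S) (hq' : q' ∈ S) (h : Crosses p q a b) (h' : Crosses p' q' c d)
    (hn : ¬ Crosses a b c d) : ∃ x ∈ S, ∃ y ∈ S, Crosses x y a b ∧ Crosses x y c d := by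
  obtain ⟨x, hx, y, hy, h₁, h₂⟩ := h.exists_separated hp hq
  obtain ⟨z, hz, t, ht, h₃, h₄⟩ := h'.exists_separated hp' hq'
  by_cases hz₁ : CycLt a z b ∧ CycLt d y c
  · exact ⟨z, hz, y, hy, .inl ⟨hz₁.1, h₂⟩, .inl ⟨h₃, hz₁.2⟩⟩
  by_cases hz₂ : CycLt b z a ∧ CycLt d x c
  · exact ⟨z, hz, x, hx, .inr ⟨h₁, hz₂.1⟩, .inl ⟨h₃, hz₂.2⟩⟩
  by_cases hz₃ : CycLt a t b ∧ CycLt c y d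
  · exact ⟨t, ht, y, hy, .inl ⟨hz₃.1, h₂⟩, .inr ⟨hz₃.2, h₄⟩⟩
  by_cases hz₄ : CycLt b t a ∧ CycLt c x d
  · exact ⟨t, ht, x, hx, .inr ⟨h₁, hz₄.1⟩, .inr ⟨hz₄.2, h₄⟩⟩
  exfalso
  clear h h' hp hq hp' hq' hx hy hz ht
  have h₅ : a.val < x.val ∧ x.val < b.val ∧ b.val < y.val ∨
      x.val < b.val ∧ b.val < y.val ∧ y.val < a.val ∨
      b.val < y.val ∧ y.val < a.val ∧ a.val < x.val ∨
      y.val < a.val ∧ a.val < x.val ∧ x.val < b.val := by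
    simp only [CycLt] at h₁ h₂
    omega
  have h₆ : c.val < z.val ∧ z.val < d.val ∧ d.val < t.val ∨
      z.val < d.val ∧ d.val < t.val ∧ t.val < c.val ∨
      d.val < t.val ∧ t.val < c.val ∧ c.val < z.val ∨
      t.val < c.val ∧ c.val < z.val ∧ z.val < d.val := by
    simp only [CycLt] at h₃ h₄
    omega
  clear h₁ h₂ h₃ h₄
  simp only [Crosses, CycLt] at *
  rcases h₅ with h₅ | h₅ | h₅ | h₅ <;> rcases h₆ with h₆ | h₆ | h₆ | h₆ <;> grind

end Rotation

section ThreeStars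

variable {Vm : Type*} {r : ℕ} {adj : Fin r → Vm → Prop}

theorem adj_unrot (k : Fin r) {i : Fin r} {w : Vm} (h : adj i w) :
    adj (cycRot k (cycUnrot k i)) w := by
  rwa [cycRot_cycUnrot]

theorem cycUnrot_self (k : Fin r) : (cycUnrot k k).val = 0 := by
  simp [cycUnrot]

theorem KuratowskiPlanar.false_of_point_in_arc_of_zero (hr : 3 ≤ r)
    (hG : KuratowskiPlanar (augmentedGraph r adj)) {y p z y' q s z' : Fin r} {X Y Z : Vm}
    (hXY : X ≠ Y) (hXZ : X ≠ Z) (hYZ : Y ≠ Z) (hy : adj y Y) (hy' : adj y' Y) (hz : adj z Z)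
    (hz' : adj z' Z) (hp : adj p X) (hq : adj q X) (hs : adj s X) (h₀ : y.val = 0)
    (h₁ : CycLt y p z) (h₂ : CycLt y z y') (h₃ : CycLt y y' z') (h₄ : CycLt y y' q)
    (h₅ : CycLt z s z') : False := by
  simp only [CycLt] at h₁ h₂ h₃ h₄ h₅
  have hyp : y < p := Fin.lt_def.2 (by omega)
  have hpz : p < z := Fin.lt_def.2 (by omega)
  have hzy : z < y' := Fin.lt_def.2 (by omega)
  have hyz : y' < z' := Fin.lt_def.2 (by omega)
  have hyq : y' < q := Fin.lt_def.2 (by omega)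
  have hzs : z < s := Fin.lt_def.2 (by omega)
  have hsz : s < z' := Fin.lt_def.2 (by omega)
  clear h₁ h₂ h₃ h₄ h₅
  rcases lt_trichotomy q z' with hqz | hqz | hqz
  · exact hG.false_of_three_chords hr h₀ hyp hpz hzy hyq hqz hXY.symm hYZ hXZ hy hy' hp hq hz hz'
  · subst hqz
    rcases lt_trichotomy s y' with hsy | rfl | hsy
    · exact hG.false_of_tripod_last_corner hr h₀ hyp hpz hzs hsy hyz hXY hXZ hYZ hp hs hq hy hy'
        hz hz'
    · exact hG.false_of_tripod_two_corners hr h₀ hyp hpz hzs hsz hXY hXZ hYZ hp hs hq hy hy' hz hz'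
    · exact hG.false_of_three_chords hr h₀ hyp hpz hzy hsy hsz hXY.symm hYZ hXZ hy hy' hp hs hz hz'
  · rcases lt_trichotomy s y' with hsy | rfl | hsy
    · exact hG.false_of_three_chords hr h₀ (hyp.trans hpz) hzs hsy hyz hqz hYZ hXY.symm hXZ.symm
        hy hy' hz hz' hs hq
    · exact hG.false_of_tripod_middle_corner hr h₀ hyp hpz hzs hsz hqz hXY hXZ hYZ hp hs hq hy hy'
        hz hz'
    · exact hG.false_of_three_chords hr h₀ hyp hpz hzy hsy hsz hXY.symm hYZ hXZ hy hy' hp hs hz hz'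

theorem KuratowskiPlanar.false_of_point_in_arc (hr : 3 ≤ r)
    (hG : KuratowskiPlanar (augmentedGraph r adj)) {y p z y' q s z' : Fin r} {X Y Z : Vm}
    (hXY : X ≠ Y) (hXZ : X ≠ Z) (hYZ : Y ≠ Z) (hy : adj y Y) (hy' : adj y' Y) (hz : adj z Z)
    (hz' : adj z' Z) (hp : adj p X) (hq : adj q X) (hs : adj s X)
    (h₁ : CycLt y p z) (h₂ : CycLt y z y') (h₃ : CycLt y y' z') (h₄ : CycLt y y' q)
    (h₅ : CycLt z s z') : False :=
  (hG.rotate y).false_of_point_in_arc_of_zero hr hXY hXZ hYZ (adj_unrot y hy) (adj_unrot y hy')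
    (adj_unrot y hz) (adj_unrot y hz') (adj_unrot y hp) (adj_unrot y hq) (adj_unrot y hs)
    (cycUnrot_self y) (h₁.unrot y) (h₂.unrot y) (h₃.unrot y) (h₄.unrot y) (h₅.unrot y)

theorem KuratowskiPlanar.false_of_four_corners_cyclic (hr : 3 ≤ r)
    (hG : KuratowskiPlanar (augmentedGraph r adj)) {a b c d : Fin r} {X Y Z : Vm}
    (hXY : X ≠ Y) (hXZ : X ≠ Z) (hYZ : Y ≠ Z) (ha : adj a X) (hb : adj b X) (hc : adj c X)
    (hd : adj d X) (ha' : adj a Y) (hc' : adj c Y) (hb' : adj b Z) (hd' : adj d Z)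
    (h₁ : CycLt a b c) (h₂ : CycLt a c d) : False := by
  have h₁ := h₁.unrot a
  have h₂ := h₂.unrot a
  have h₀ := cycUnrot_self a
  simp only [CycLt] at h₁ h₂
  exact (hG.rotate a).false_of_four_corners hr h₀ (Fin.lt_def.2 (by omega))
      (Fin.lt_def.2 (by omega))
    (Fin.lt_def.2 (by omega)) hXY hXZ hYZ (adj_unrot a ha) (adj_unrot a hb) (adj_unrot a hc)
    (adj_unrot a hd) (adj_unrot a ha') (adj_unrot a hc') (adj_unrot a hb') (adj_unrot a hd')

theorem KuratowskiPlanar.false_of_separated (hr : 3 ≤ r)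
    (hG : KuratowskiPlanar (augmentedGraph r adj)) {y p z y' q s z' t : Fin r} {X Y Z : Vm}
    (hXY : X ≠ Y) (hXZ : X ≠ Z) (hYZ : Y ≠ Z) (hy : adj y Y) (hy' : adj y' Y) (hz : adj z Z)
    (hz' : adj z' Z) (hp : adj p X) (hq : adj q X) (hs : adj s X) (ht : adj t X)
    (h₁ : CycLt y z y') (h₂ : CycLt y y' z') (h₃ : CycLt y p y') (h₄ : CycLt y' q y)
    (h₅ : CycLt z s z') (h₆ : CycLt z' t z) : False := by
  have hzz' : CycLt z y' z' := by
    simp only [CycLt] at h₁ h₂ ⊢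
    omega
  have hz'z : CycLt z' y z := by
    simp only [CycLt] at h₁ h₂ ⊢
    omega
  have key : ∀ x, adj x X → x = y ∨ x = z ∨ x = y' ∨ x = z' := by
    intro x hx
    by_contra! hne
    have hyy : y ≠ y' := by
      rintro rfl
      simp only [CycLt] at h₁
      omega
    have h₇ : CycLt y' z' y := h₂.rotl
    have : CycLt y x z ∨ CycLt z x y' ∨ CycLt y' x z' ∨ CycLt z' x y := by
      rcases CycLt.total hyy hne.1 hne.2.2.1 with h | h
      · exact (h.split h₁ hne.2.1).elim .inl fun h => .inr (.inl h)
      · exact .inr (.inr (h.split h₇ hne.2.2.2))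
    rcases this with h | h | h | h
    · exact hG.false_of_point_in_arc hr hXY hXZ hYZ hy hy' hz hz' hx hq hs h h₁ h₂ h₄.rotl.rotl h₅
    · exact hG.false_of_point_in_arc hr hXZ hXY hYZ.symm hz hz' hy' hy hx ht hq h
        hzz' hz'z.rotl.rotl h₆.rotl.rotl h₄
    · exact hG.false_of_point_in_arc hr hXY hXZ hYZ hy' hy hz' hz hx hp ht h
        h₇ h₁.rotl.rotl h₃.rotl.rotl h₆
    · exact hG.false_of_point_in_arc hr hXZ hXY hYZ.symm hz' hz hy hy' hx hs hp h
        hz'z hzz'.rotl.rotl h₅.rotl.rotl h₃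
  have hpz : p = z := h₃.eq_of_mem h₂.rotl (key p hp)
  have hqz : q = z' := h₄.eq_of_mem h₁ (by have := key q hq; tauto)
  have hsy : s = y' := h₅.eq_of_mem hz'z (by have := key s hs; tauto)
  have hty : t = y := h₆.eq_of_mem hzz' (by have := key t ht; tauto)
  subst hpz hqz hsy hty
  exact hG.false_of_four_corners_cyclic hr hXY hXZ hYZ ht hp hs hq hy hy' hz hz' h₁ h₂

theorem KuratowskiPlanar.false_of_crosses (hr : 3 ≤ r)
    (hG : KuratowskiPlanar (augmentedGraph r adj)) {x₁ x₂ x₃ x₄ y y' z z' : Fin r} {X Y Z : Vm}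
    (hXY : X ≠ Y) (hXZ : X ≠ Z) (hYZ : Y ≠ Z) (h₁ : adj x₁ X) (h₂ : adj x₂ X) (h₃ : adj x₃ X)
    (h₄ : adj x₄ X) (hy : adj y Y) (hy' : adj y' Y) (hz : adj z Z) (hz' : adj z' Z)
    (hxy : Crosses x₁ x₂ y y') (hxz : Crosses x₃ x₄ z z') (hyz : Crosses y y' z z') : False := by
  wlog h : CycLt y z y' generalizing z z'
  · refine this hz' hz hxz.swap_right hyz.swap_right ?_
    simp only [Crosses, CycLt] at *
    omega
  obtain ⟨p, hp, q, hq, hpy, hqy⟩ := hxy.exists_separated (S := {i | adj i X}) h₁ h₂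
  obtain ⟨s, hs, t, ht, hsz, htz⟩ := hxz.exists_separated (S := {i | adj i X}) h₃ h₄
  refine hG.false_of_separated hr hXY hXZ hYZ hy hy' hz hz' hp hq hs ht h ?_ hpy hqy hsz htz
  clear hpy hqy hsz htz hxy hxz
  simp only [Crosses, CycLt] at *
  omega

/-- Three mobile vertices cannot conflict pairwise. -/
theorem KuratowskiPlanar.false_of_three_conflicts (hr : 3 ≤ r)
    (hG : KuratowskiPlanar (augmentedGraph r adj)) {X Y Z : Vm}
    (hXY : X ≠ Y) (hXZ : X ≠ Z) (hYZ : Y ≠ Z) (h₁ : Conflict {i | adj i Y} {i | adj i Z})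
    (h₂ : Conflict {i | adj i Y} {i | adj i X}) (h₃ : Conflict {i | adj i X} {i | adj i Z}) :
    False := by
  obtain ⟨y₁, hy₁, y₂, hy₂, z₁, hz₁, z₂, hz₂, h₁⟩ := h₁
  obtain ⟨y₃, hy₃, y₄, hy₄, x₃, hx₃, x₄, hx₄, h₂⟩ := h₂
  obtain ⟨x₅, hx₅, x₆, hx₆, z₅, hz₅, z₆, hz₆, h₃⟩ := h₃
  by_cases hc : Crosses z₁ z₂ x₃ x₄
  · exact hG.false_of_crosses hr hYZ hXY.symm hXZ.symm hy₁ hy₂ hy₃ hy₄ hz₁ hz₂ hx₃ hx₄ h₁ h₂ hc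
  obtain ⟨y₅, hy₅, y₆, hy₆, h₄, h₅⟩ := exists_crosses_both hy₁ hy₂ hy₃ hy₄ h₁ h₂ hc
  by_cases hc' : Crosses y₅ y₆ z₅ z₆
  · exact hG.false_of_crosses hr hXY hXZ hYZ hx₃ hx₄ hx₅ hx₆ hy₅ hy₆ hz₅ hz₆ h₅.symm h₃ hc'
  obtain ⟨x₇, hx₇, x₈, hx₈, h₆, h₇⟩ := exists_crosses_both hx₃ hx₄ hx₅ hx₆ h₅.symm h₃ hc'
  exact hG.false_of_crosses hr hYZ.symm hXZ.symm hXY.symm hz₁ hz₂ hz₅ hz₆ hy₅ hy₆ hx₇ hx₈ h₄.symm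
    h₇.symm h₆.symm

end ThreeStars

section OddCycle

theorem add_one_mod_eq {k n : ℕ} (hn : 0 < n) :
    (k + 1) % n = if k % n + 1 = n then 0 else k % n + 1 := by
  rw [← succ_mod_eq (Nat.mod_lt k hn)]
  simp

variable {V : Type*} {G : SimpleGraph V}

/-- `c` is an odd closed walk of length `n`, regarded as a periodic sequence. -/
def IsOddLoop (G : SimpleGraph V) (n : ℕ) (c : ℕ → V) : Prop :=
  Odd n ∧ (∀ i, G.Adj (c i) (c (i + 1))) ∧ ∀ i, c (i + n) = c i

/-- Closing up a sequence of consecutively adjacent vertices whose ends are adjacent. -/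
theorem exists_isOddLoop_of_adj {c : ℕ → V} {m : ℕ} (hc : ∀ i, G.Adj (c i) (c (i + 1)))
    (hm : Even m) (h : G.Adj (c m) (c 0)) : ∃ c', IsOddLoop G (m + 1) c' := by
  refine ⟨fun k => c (k % (m + 1)), hm.add_one, fun k => ?_, fun k => by simp⟩
  show G.Adj (c (k % (m + 1))) (c ((k + 1) % (m + 1)))
  rw [add_one_mod_eq (show 0 < m + 1 by omega)]
  split_ifs with hk
  · have : k % (m + 1) = m := by omega
    rwa [this]
  · exact hc _

theorem exists_isOddLoop_of_not_colorable (h : ¬ G.Colorable 2) : ∃ n c, IsOddLoop G n c := by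
  rw [two_colorable_iff_forall_loop_even] at h
  push Not at h
  obtain ⟨u, w, hw⟩ := h
  obtain ⟨m, hm⟩ := Nat.not_even_iff_odd.1 hw
  have hadj : ∀ i, i ≤ 2 * m → G.Adj (w.getVert i) (w.getVert (i + 1)) := fun i hi =>
    w.adj_getVert_succ (by omega)
  refine ⟨2 * m + 1, fun i => w.getVert (i % (2 * m + 1)), ⟨m, rfl⟩, fun i => ?_, fun i => by simp⟩
  show G.Adj (w.getVert (i % (2 * m + 1))) (w.getVert ((i + 1) % (2 * m + 1)))
  rw [add_one_mod_eq (show 0 < 2 * m + 1 by omega)]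
  have hlt := Nat.mod_lt i (show 2 * m + 1 > 0 by omega)
  split_ifs with hk
  · have := hadj (i % (2 * m + 1)) (by omega)
    have hu : w.getVert (2 * m + 1) = w.getVert 0 := by
      rw [← hm, w.getVert_length, w.getVert_zero]
    rwa [hk, hu] at this
  · exact hadj _ (by omega)

/-- In a shortest odd closed walk, vertices are distinct and there are no chords. -/
theorem exists_shortest_isOddLoop (h : ¬ G.Colorable 2) : ∃ n c, IsOddLoop G n c ∧ 3 ≤ n ∧
    (∀ i j, i < j → j < i + n → c i ≠ c j) ∧
    ∀ i j, i + 2 ≤ j → j + 2 ≤ i + n → ¬ G.Adj (c i) (c j) := by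
  classical
  have hex := exists_isOddLoop_of_not_colorable h
  obtain ⟨c, hn, hadj, hper⟩ := Nat.find_spec hex
  set n := Nat.find hex
  have hmin : ∀ i m, Even m → G.Adj (c (i + m)) (c i) → n ≤ m + 1 := by
    intro i m hm hi
    refine Nat.find_min' hex (exists_isOddLoop_of_adj (c := fun k => c (i + k)) ?_ hm hi)
    exact fun k => hadj (i + k)
  refine ⟨n, c, ⟨hn, hadj, hper⟩, ?_, ?_, ?_⟩
  · have : n ≠ 1 := fun h1 => by
      have := hadj 0
      rw [← h1, hper] at this
      exact this.ne rfl
    obtain ⟨k, hk⟩ := hn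
    omega
  · intro i j hij hj he
    rcases Nat.even_or_odd (j - i) with hd | hd
    · have h1 : G.Adj (c (j + (n - (j - i) - 1))) (c j) := by
        have := hadj (j + (n - (j - i) - 1))
        rwa [show j + (n - (j - i) - 1) + 1 = i + n by omega, hper, he] at this
      have := hmin j _ (by rw [Nat.odd_iff] at hn; rw [Nat.even_iff] at *; omega) h1
      omega
    · have h1 : G.Adj (c (i + (j - i - 1))) (c i) := by
        have := hadj (i + (j - i - 1))
        rwa [show i + (j - i - 1) + 1 = j by omega, ← he] at this
      have := hmin i _ (by rw [Nat.odd_iff] at hd; rw [Nat.even_iff] at *; omega) h1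
      omega
  · intro i j hij hj ha
    rcases Nat.even_or_odd (j - i) with hd | hd
    · have := hmin i (j - i) hd (by rw [show i + (j - i) = j by omega]; exact ha.symm)
      omega
    · have := hmin j (n - (j - i))
        (by rw [Nat.odd_iff] at hd hn; rw [Nat.even_iff] at *; omega)
        (by rwa [show j + (n - (j - i)) = i + n by omega, hper])
      omega

end OddCycle

section ChordChoice

variable {r n : ℕ}

/-- In a chordless cycle of conflicting sets, one chord can be chosen in each set so that
consecutive chords cross. -/
theorem exists_crossing_chords (hn : 4 ≤ n) {S : ℕ → Set (Fin r)} (hper : ∀ i, S (i + n) = S i)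
    (hS : ∀ i, Conflict (S i) (S (i + 1)))
    (hS' : ∀ i j, i + 2 ≤ j → j + 2 ≤ i + n → ¬ Conflict (S i) (S j)) :
    ∃ p q : ℕ → Fin r, (∀ i, p i ∈ S i ∧ q i ∈ S i) ∧ (∀ i, p (i + n) = p i ∧ q (i + n) = q i) ∧
      ∀ i, Crosses (p i) (q i) (p (i + 1)) (q (i + 1)) := by
  have key : ∀ m ≤ n, ∃ N : ℕ → Set (Fin r), (∀ i, N i ⊆ S i) ∧ (∀ i, N (i + n) = N i) ∧
      (∀ i, Conflict (N i) (N (i + 1))) ∧ ∀ i < m, ∃ p q, N i = {p, q} := by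
    intro m hm
    induction m with
    | zero => exact ⟨S, fun i => subset_rfl, hper, hS, fun i hi => absurd hi i.not_lt_zero⟩
    | succ m ih =>
      obtain ⟨N, hN, hNper, hNS, hNm⟩ := ih (by omega)
      have hmod : ∀ i, N (i % n) = N i := fun i => Function.Periodic.map_mod_nat hNper i
      obtain ⟨a, ha, b, hb, c, hc, d, hd, h₁⟩ := hNS m
      have h₂ := hNS (m + n - 1)
      rw [show m + n - 1 + 1 = m + n by omega, hNper] at h₂
      obtain ⟨c', hc', d', hd', a', ha', b', hb', h₂⟩ := h₂
      obtain ⟨p, hp, q, hq, h₃, h₄⟩ := exists_crosses_both ha hb ha' hb' h₁ h₂.symm fun h =>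
        hS' (m + 1) (m + n - 1) (by omega) (by omega)
          ⟨c, hN _ hc, d, hN _ hd, c', hN _ hc', d', hN _ hd', h⟩
      refine ⟨fun i => if i % n = m then {p, q} else N i, fun i => ?_, fun i => ?_, fun i => ?_,
        fun i hi => ?_⟩
      · simp only
        split_ifs with h
        · refine subset_trans ?_ (hN i)
          rw [← hmod, h]
          rintro x (rfl | rfl) <;> assumption
        · exact hN i
      · simp [hNper]
      · have hlt := Nat.mod_lt i (show n > 0 by omega)
        have hsucc := add_one_mod_eq (k := i) (show 0 < n by omega)
        simp only
        split_ifs with h h' h'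
        · rw [h'] at hsucc
          split_ifs at hsucc <;> omega
        · have hi : N (i + 1) = N (m + 1) := by
            rw [← hmod (i + 1), ← hmod (m + 1), hsucc, add_one_mod_eq (by omega), h,
              Nat.mod_eq_of_lt (by omega)]
          rw [hi]
          exact ⟨p, by simp, q, by simp, c, hc, d, hd, h₃⟩
        · have hi : N i = N (m + n - 1) := by
            rw [← hmod i, ← hmod (m + n - 1)]
            congr 1
            rw [h'] at hsucc
            split_ifs at hsucc with h''
            · rw [Nat.mod_eq_of_lt (a := m + n - 1) (by omega)]
              omega
            · rw [show m + n - 1 = i % n + n by omega]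
              simp
          rw [hi]
          exact ⟨c', hc', d', hd', p, by simp, q, by simp, h₄.symm⟩
        · exact hNS i
      · rcases Nat.lt_succ_iff_lt_or_eq.1 hi with h | rfl
        · obtain ⟨x, y, h'⟩ := hNm i h
          refine ⟨x, y, ?_⟩
          simp only
          rw [if_neg, h']
          rw [Nat.mod_eq_of_lt (by omega)]
          omega
        · exact ⟨p, q, if_pos (Nat.mod_eq_of_lt (by omega))⟩
  obtain ⟨N, hN, hNper, hNS, hNn⟩ := key n le_rfl
  have hmod : ∀ i, N (i % n) = N i := fun i => Function.Periodic.map_mod_nat hNper i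
  have hex : ∀ i, ∃ p q, N (i % n) = {p, q} := fun i => hNn _ (Nat.mod_lt _ (by omega))
  have hex' : ∃ p q : ℕ → Fin r, ∀ i, N (i % n) = {p (i % n), q (i % n)} := by
    choose p q h using hex
    exact ⟨p, q, fun i => by simpa using h (i % n)⟩
  obtain ⟨p, q, hpq⟩ := hex'
  refine ⟨fun i => p (i % n), fun i => q (i % n), fun i => ?_, fun i => by simp, fun i => ?_⟩
  · have h : {p (i % n), q (i % n)} ⊆ S i := by
      rw [← hpq, hmod]
      exact hN i
    exact ⟨h (by simp), h (by simp)⟩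
  · obtain ⟨a, ha, b, hb, c, hc, d, hd, h⟩ := hNS i
    rw [← hmod, hpq] at ha hb hc hd
    have haux : ∀ {x y a b c d : Fin r}, a ∈ ({x, y} : Set (Fin r)) → b ∈ ({x, y} : Set (Fin r)) →
        Crosses a b c d → Crosses x y c d := by
      rintro x y a b c d (rfl | rfl) (rfl | rfl) h
      · simp only [Crosses, CycLt] at h
        omega
      · exact h
      · exact h.swap_left
      · simp only [Crosses, CycLt] at h
        omega
    exact (haux hc hd (haux ha hb h).symm).symm

end ChordChoice

section Unrolling

/-- The intervals `[a, b]` and `[c, d]` overlap without being nested or merely touching. -/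
def Overlap (a b c d : ℕ) : Prop :=
  a < c ∧ c < b ∧ b < d ∨ c < a ∧ a < d ∧ d < b

/-- A ring of `n` chords, consecutive ones crossing, unrolled along the points `0, …, r` of the
cycle cut open at the first end of chord `0`. Chord `i` has ends `l i` and `h i`, except for chord
`n - 1` whose ends are `l (n - 1)` and `u`. -/
structure IsUnrolledRing (n r u : ℕ) (l h : ℕ → ℕ) : Prop where
  l_zero : l 0 = 0
  l_lt_l : ∀ i, i + 1 < n → l i < l (i + 1)
  l_lt_h : ∀ i, i + 1 < n → l (i + 1) < h i
  h_le_l : ∀ i, i + 2 < n → h i ≤ l (i + 2)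
  h_le : h (n - 2) ≤ r
  u_pos : 0 < u
  u_le : u ≤ l 1

theorem isUnrolledRing_of_overlap {n b r : ℕ} {l h : ℕ → ℕ} (hn : 5 ≤ n)
    (hlt : ∀ j, 1 ≤ j → j < n → l j < h j)
    (hb : ∀ j, 2 ≤ j → j + 2 ≤ n → b ≤ l j) (hr : ∀ j, 2 ≤ j → j + 2 ≤ n → h j ≤ r)
    (hl₁ : 0 < l (n - 1)) (hb₁ : l 1 < b) (hb₁' : b < h 1)
    (hX : ∀ j, 1 ≤ j → j + 1 < n → Overlap (l j) (h j) (l (j + 1)) (h (j + 1)))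
    (hN : ∀ i j, 1 ≤ i → i + 2 ≤ j → j < n → ¬ Overlap (l i) (h i) (l j) (h j))
    (hl : l (n - 1) ≤ l 1) (hh : h 1 ≤ h (n - 1)) :
    IsUnrolledRing n r (l (n - 1)) (fun i => if i = 0 then 0 else if i = n - 1 then h i else l i)
      (fun i => if i = 0 then b else h i) := by
  simp only [Overlap] at hX hN
  have inside : ∀ i, 1 ≤ i → i + 3 ≤ n → l (n - 1) ≤ l i ∧ h i ≤ h (n - 1) := by
    intro i hi
    induction i, hi using Nat.le_induction with
    | base => exact fun _ => ⟨hl, hh⟩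
    | succ i hi ih =>
      intro hin
      have h1 := ih (by omega)
      have h2 := hX i hi (by omega)
      have h3 := hN (i + 1) (n - 1) (by omega) (by omega) (by omega)
      omega
  have last : l (n - 2) < h (n - 1) ∧ h (n - 1) < h (n - 2) := by
    have h1 := hX (n - 2) (by omega) (by omega)
    rw [show n - 2 + 1 = n - 1 by omega] at h1
    have h2 := hb (n - 2) (by omega) (by omega)
    omega
  have notnested : ∀ i, 1 ≤ i → ∀ j, i + 2 ≤ j → j + 2 ≤ n → ¬ (l j ≤ l i ∧ h i ≤ h j) := by
    intro i hi
    induction i, hi using Nat.le_induction with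
    | base =>
      intro j hj hjn hc
      have := hb j (by omega) hjn
      omega
    | succ i hi ih =>
      intro j hj hjn hc
      have h1 := hX i hi (by omega)
      have h2 := hN i j hi (by omega) (by omega)
      have h3 := ih j (by omega) hjn
      omega
  have notnested' : ∀ i, 1 ≤ i → ∀ k j, j + k = n - 2 → i + 2 ≤ j → ¬ (l i ≤ l j ∧ h j ≤ h i) := by
    intro i hi k
    induction k with
    | zero =>
      intro j hj hij hc
      obtain rfl : j = n - 2 := by omega
      have := inside i hi (by omega)
      omega
    | succ k ih =>
      intro j hj hij hc
      have h1 := hX j (by omega) (by omega)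
      have h2 := hN i (j + 1) hi (by omega) (by omega)
      have h3 := ih (j + 1) (by omega) (by omega)
      omega
  have disj : ∀ i j, 1 ≤ i → i + 2 ≤ j → j + 2 ≤ n → h i ≤ l j ∨ h j ≤ l i := by
    intro i j hi hij hj
    have h1 := hN i j hi hij (by omega)
    have h2 := notnested i hi j hij hj
    have h3 := notnested' i hi (n - 2 - j) j (by omega) hij
    have h4 := hlt i hi (by omega)
    have h5 := hlt j (by omega) (by omega)
    omega
  have chain : ∀ i, 1 ≤ i → i + 3 ≤ n → l i < l (i + 1) ∧ l (i + 1) < h i ∧ h i < h (i + 1) := by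
    intro i hi
    induction i, hi using Nat.le_induction with
    | base =>
      intro _
      have h1 := hX 1 (by omega) (by omega)
      have h2 := hb 2 (by omega) (by omega)
      norm_num at *
      omega
    | succ i hi ih =>
      intro hin
      have h1 := ih (by omega)
      have h2 := hX (i + 1) (by omega) (by omega)
      have h3 := disj i (i + 2) hi le_rfl (by omega)
      rw [show i + 1 + 1 = i + 2 by omega] at *
      omega
  have chain' : ∀ i, 1 ≤ i → i + 4 ≤ n → h i ≤ l (i + 2) := by
    intro i hi hin
    have h1 := chain i hi (by omega)
    have h2 := chain (i + 1) (by omega) (by omega)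
    have h3 := disj i (i + 2) hi le_rfl (by omega)
    have h4 := hlt (i + 2) (by omega) (by omega)
    rw [show i + 1 + 1 = i + 2 by omega] at *
    omega
  have hl₁' := inside 1 le_rfl (by omega)
  refine ⟨by simp, fun i hi => ?_, fun i hi => ?_, fun i hi => ?_, ?_, hl₁, ?_⟩
  · rcases Nat.eq_zero_or_pos i with rfl | hi0
    · simp [show ¬ (1 = n - 1) by omega]
      omega
    · by_cases hin : i + 1 = n - 1
      · obtain rfl : i = n - 2 := by omega
        simp [hin, show ¬ (n - 2 = 0) by omega, show ¬ (n - 2 = n - 1) by omega,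
          show ¬ (n - 1 = 0) by omega, last]
      · simp [hin, show ¬ (i = 0) by omega, show ¬ (i = n - 1) by omega,
          chain i hi0 (by omega)]
  · rcases Nat.eq_zero_or_pos i with rfl | hi0
    · simp [show ¬ (1 = n - 1) by omega, hb₁]
    · by_cases hin : i + 1 = n - 1
      · obtain rfl : i = n - 2 := by omega
        simp [hin, show ¬ (n - 2 = 0) by omega, show ¬ (n - 1 = 0) by omega, last]
      · simp [hin, show ¬ (i = 0) by omega, chain i hi0 (by omega)]
  · rcases Nat.eq_zero_or_pos i with rfl | hi0
    · simp [show ¬ (2 = n - 1) by omega, hb 2 le_rfl (by omega)]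
    · by_cases hin : i + 2 = n - 1
      · obtain rfl : i = n - 3 := by omega
        simp [hin, show ¬ (n - 3 = 0) by omega, show ¬ (n - 1 = 0) by omega,
          inside (n - 3) (by omega) (by omega)]
      · simp [hin, show ¬ (i = 0) by omega, chain' i hi0 (by omega)]
  · simp [show ¬ (n - 2 = 0) by omega, hr (n - 2) (by omega) (by omega)]
  · simp [show ¬ (1 = n - 1) by omega, hl]

end Unrolling

section RingExtraction

variable {r : ℕ}

/-- The distance from `a` to `x` along the cycle, in `1, …, r`. -/
def cycDist (a x : Fin r) : ℕ :=
  if a.val < x.val then x.val - a.val else x.val + r - a.val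

theorem cycDist_pos (a x : Fin r) : 0 < cycDist a x := by
  have := a.isLt
  have := x.isLt
  unfold cycDist
  split <;> omega

theorem cycDist_le (a x : Fin r) : cycDist a x ≤ r := by
  have := a.isLt
  have := x.isLt
  unfold cycDist
  split <;> omega

theorem cycDist_self (a : Fin r) : cycDist a a = r := by
  simp [cycDist]

theorem cycLt_iff_cycDist (a x y z : Fin r) : CycLt x y z ↔
    cycDist a x < cycDist a y ∧ cycDist a y < cycDist a z ∨
    cycDist a y < cycDist a z ∧ cycDist a z < cycDist a x ∨
    cycDist a z < cycDist a x ∧ cycDist a x < cycDist a y := by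
  have := a.isLt
  have := x.isLt
  have := y.isLt
  have := z.isLt
  unfold cycDist CycLt
  split_ifs <;> omega

theorem crosses_iff_overlap (a p q x y : Fin r) : Crosses p q x y ↔
    Overlap (min (cycDist a p) (cycDist a q)) (max (cycDist a p) (cycDist a q))
      (min (cycDist a x) (cycDist a y)) (max (cycDist a x) (cycDist a y)) := by
  simp only [Crosses, cycLt_iff_cycDist a, Overlap]
  rcases le_total (cycDist a p) (cycDist a q) with h | h <;>
    rcases le_total (cycDist a x) (cycDist a y) with h' | h' <;> simp only [h, h', min_eq_left,
      min_eq_right, max_eq_left, max_eq_right] <;> omega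

theorem cycDist_lt {a b : Fin r} (hab : a ≠ b) : cycDist a b < r := by
  have := b.isLt
  rw [ne_eq, Fin.ext_iff] at hab
  unfold cycDist
  split <;> omega

theorem cycLt_self_iff {a b : Fin r} (hab : a ≠ b) (x : Fin r) :
    CycLt a x b ↔ cycDist a x < cycDist a b := by
  rw [cycLt_iff_cycDist a, cycDist_self]
  have := cycDist_le a x
  have := cycDist_lt hab
  omega

theorem not_cycLt_of_crosses {a b p q p' q' : Fin r} (hab : a ≠ b) (hp : ¬ CycLt a p b)
    (hq : ¬ CycLt a q b) (h : Crosses p q p' q') (h' : ¬ Crosses a b p' q') :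
    ¬ CycLt a p' b ∧ ¬ CycLt a q' b := by
  rw [crosses_iff_overlap a] at h h'
  rw [cycLt_self_iff hab] at hp hq ⊢
  rw [cycLt_self_iff hab]
  rw [cycDist_self] at h'
  have := cycDist_lt hab
  have := cycDist_le a p
  have := cycDist_le a q
  have := cycDist_le a p'
  have := cycDist_le a q'
  simp only [Overlap] at *
  omega

/-- The chords other than the first and its two neighbours lie on one side of the first. -/
theorem exists_side {n : ℕ} {p q : ℕ → Fin r} (hn : 4 ≤ n)
    (hX : ∀ i, Crosses (p i) (q i) (p (i + 1)) (q (i + 1)))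
    (hN : ∀ i j, i + 2 ≤ j → j + 2 ≤ i + n → ¬ Crosses (p i) (q i) (p j) (q j)) :
    ∃ a b, (a = p 0 ∧ b = q 0 ∨ a = q 0 ∧ b = p 0) ∧ ∀ j, 2 ≤ j → j + 2 ≤ n →
      ¬ CycLt a (p j) b ∧ ¬ CycLt a (q j) b := by
  have hne : p 0 ≠ q 0 := fun h => by
    have := hX 0
    simp only [Crosses, CycLt, h] at this
    omega
  have key : ∀ a b, (a = p 0 ∧ b = q 0 ∨ a = q 0 ∧ b = p 0) →
      (¬ CycLt a (p 2) b ∧ ¬ CycLt a (q 2) b) → ∀ j, 2 ≤ j → j + 2 ≤ n →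
      ¬ CycLt a (p j) b ∧ ¬ CycLt a (q j) b := by
    intro a b hab h2 j hj
    induction j, hj using Nat.le_induction with
    | base => exact fun _ => h2
    | succ j hj ih =>
      intro hjn
      have h := ih (by omega)
      have h0 := hN 0 (j + 1) (by omega) (by omega)
      rcases hab with ⟨rfl, rfl⟩ | ⟨rfl, rfl⟩
      · exact not_cycLt_of_crosses hne h.1 h.2 (hX j) h0
      · exact not_cycLt_of_crosses hne.symm h.1 h.2 (hX j) fun h => h0 h.swap_left
  by_cases h : ¬ CycLt (p 0) (p 2) (q 0) ∧ ¬ CycLt (p 0) (q 2) (q 0)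
  · exact ⟨p 0, q 0, .inl ⟨rfl, rfl⟩, key _ _ (.inl ⟨rfl, rfl⟩) h⟩
  · refine ⟨q 0, p 0, .inr ⟨rfl, rfl⟩, key _ _ (.inr ⟨rfl, rfl⟩) ?_⟩
    have h0 := hN 0 2 le_rfl (by omega)
    rw [crosses_iff_overlap (p 0)] at h0
    rw [cycLt_iff_cycDist (p 0), cycLt_iff_cycDist (p 0) (q 0)]
    rw [cycLt_self_iff hne, cycLt_self_iff hne] at h
    have := cycDist_le (p 0) (p 2)
    have := cycDist_le (p 0) (q 2)
    have := cycDist_le (p 0) (q 0)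
    simp only [cycDist_self, Overlap] at *
    omega

end RingExtraction

section RingStructure

variable {Vm : Type*} {r n u : ℕ} {adj : Fin r → Vm → Prop} {l h : ℕ → ℕ} {c : ℕ → Vm}

/-- The mobile vertex `w` is adjacent to the fixed vertex at position `x` modulo `r`. -/
def IncAt (adj : Fin r → Vm → Prop) (x : ℕ) (w : Vm) : Prop :=
  ∃ i : Fin r, adj i w ∧ i.val = x % r

/-- The mobile vertices `c 0, …, c (n - 1)` own the chords of an unrolled ring. -/
structure IsRing (n : ℕ) (adj : Fin r → Vm → Prop) (u : ℕ) (l h : ℕ → ℕ) (c : ℕ → Vm) : Prop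
    extends IsUnrolledRing n r u l h where
  ne : ∀ i j, i < j → j < n → c i ≠ c j
  inc_l : ∀ i, i < n → IncAt adj (l i) (c i)
  inc_h : ∀ i, i + 1 < n → IncAt adj (h i) (c i)
  inc_u : IncAt adj u (c (n - 1))

theorem incAt_cycDist (a : Fin r) {x : Fin r} {w : Vm} (h : adj x w) :
    IncAt (fun i w => adj (cycRot a i) w) (cycDist a x) w := by
  refine ⟨cycUnrot a x, adj_unrot a h, ?_⟩
  have := a.isLt
  have := x.isLt
  unfold cycUnrot cycDist
  rcases lt_trichotomy a.val x.val with h | h | h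
  · simp only [h, h.le, if_true]
    rw [Nat.mod_eq_of_lt (by omega)]
  · simp [h]
  · simp only [h.not_ge, h.not_gt, if_false]
    rw [Nat.mod_eq_of_lt (by omega)]

theorem exists_isRing {p q : ℕ → Fin r} (hn : 5 ≤ n)
    (hp : ∀ i, adj (p i) (c i)) (hq : ∀ i, adj (q i) (c i))
    (hper : ∀ i, p (i + n) = p i ∧ q (i + n) = q i) (hne : ∀ i j, i < j → j < i + n → c i ≠ c j)
    (hX : ∀ i, Crosses (p i) (q i) (p (i + 1)) (q (i + 1)))
    (hN : ∀ i j, i + 2 ≤ j → j + 2 ≤ i + n → ¬ Crosses (p i) (q i) (p j) (q j)) :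
    ∃ a u l h c', IsRing n (fun i w => adj (cycRot a i) w) u l h c' := by
  obtain ⟨a, b, hab, hside⟩ := exists_side (by omega) hX hN
  have hX0 : Crosses a b (p 1) (q 1) := by
    rcases hab with ⟨rfl, rfl⟩ | ⟨rfl, rfl⟩
    exacts [hX 0, (hX 0).swap_left]
  have hX1 : Crosses a b (p (n - 1)) (q (n - 1)) := by
    have := hX (n - 1)
    rw [show n - 1 + 1 = 0 + n by omega, (hper 0).1, (hper 0).2] at this
    rcases hab with ⟨rfl, rfl⟩ | ⟨rfl, rfl⟩
    exacts [this.symm, this.symm.swap_left]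
  have hne_ab : a ≠ b := by
    rintro rfl
    simp only [Crosses, CycLt] at hX0
    omega
  have ha : adj a (c 0) ∧ adj b (c 0) := by
    rcases hab with ⟨rfl, rfl⟩ | ⟨rfl, rfl⟩
    exacts [⟨hp 0, hq 0⟩, ⟨hq 0, hp 0⟩]
  set l : ℕ → ℕ := fun j => min (cycDist a (p j)) (cycDist a (q j)) with hl
  set h : ℕ → ℕ := fun j => max (cycDist a (p j)) (cycDist a (q j)) with hh
  have hX' : ∀ j, Overlap (l j) (h j) (l (j + 1)) (h (j + 1)) := fun j =>
    (crosses_iff_overlap a _ _ _ _).1 (hX j)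
  have hN' : ∀ i j, i + 2 ≤ j → j + 2 ≤ i + n → ¬ Overlap (l i) (h i) (l j) (h j) :=
    fun i j hi hj ho => hN i j hi hj ((crosses_iff_overlap a _ _ _ _).2 ho)
  have hlt : ∀ j, l j < h j := fun j => by
    have := hX' j
    simp only [Overlap] at this
    omega
  have hpos : ∀ j, 0 < l j := fun j => lt_min (cycDist_pos _ _) (cycDist_pos _ _)
  have hle : ∀ j, h j ≤ r := fun j => max_le (cycDist_le _ _) (cycDist_le _ _)
  have hbl : ∀ j, 2 ≤ j → j + 2 ≤ n → cycDist a b ≤ l j := by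
    intro j hj hjn
    have := hside j hj hjn
    rw [cycLt_self_iff hne_ab, cycLt_self_iff hne_ab] at this
    simp only [hl]
    omega
  have hends : ∀ j, Crosses a b (p j) (q j) → l j < cycDist a b ∧ cycDist a b < h j := by
    intro j hj
    rw [crosses_iff_overlap a, cycDist_self] at hj
    have := cycDist_lt hne_ab
    have := hle j
    simp only [Overlap, hl, hh] at *
    omega
  have h1 := hends 1 hX0
  have h1' := hends (n - 1) hX1
  have hinc : ∀ j, IncAt (fun i w => adj (cycRot a i) w) (l j) (c j) ∧
      IncAt (fun i w => adj (cycRot a i) w) (h j) (c j) := by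
    intro j
    rcases le_total (cycDist a (p j)) (cycDist a (q j)) with hj | hj
    · simp only [hl, hh, min_eq_left hj, max_eq_right hj]
      exact ⟨incAt_cycDist a (hp j), incAt_cycDist a (hq j)⟩
    · simp only [hl, hh, min_eq_right hj, max_eq_left hj]
      exact ⟨incAt_cycDist a (hq j), incAt_cycDist a (hp j)⟩
  have hinc0 : IncAt (fun i w => adj (cycRot a i) w) 0 (c 0) := by
    obtain ⟨i, hi, hi'⟩ := incAt_cycDist a ha.1
    exact ⟨i, hi, by simpa [cycDist_self] using hi'⟩
  have hincb := incAt_cycDist a ha.2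
  clear_value l h
  have hn1 : n - 1 ≠ 0 := by omega
  by_cases hcase : l (n - 1) ≤ l 1 ∧ h 1 ≤ h (n - 1)
  · refine ⟨a, _, _, _, c, isUnrolledRing_of_overlap hn (fun j _ _ => hlt j) hbl
      (fun j _ _ => hle j) (hpos _) h1.1 h1.2 (fun j _ _ => hX' j)
      (fun i j _ hij hj => hN' i j hij (by omega)) hcase.1 hcase.2,
      fun i j hij hj => hne i j hij (by omega), fun i hi => ?_, fun i hi => ?_, (hinc _).1⟩
    · split_ifs with h0 h2
      · exact h0 ▸ hinc0
      · exact (hinc i).2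
      · exact (hinc i).1
    · split_ifs with h0
      · exact h0 ▸ hincb
      · exact (hinc i).2
  · have hno := hN' 1 (n - 1) (by omega) (by omega)
    have hover : ∀ a b c d, Overlap a b c d → Overlap c d a b := fun a b c d h => h.symm.imp
      (fun h => by omega) (fun h => by omega)
    have hnn : n - (n - 1) = 1 := by omega
    refine ⟨a, _, _, _, fun i => if i = 0 then c 0 else c (n - i),
      isUnrolledRing_of_overlap (l := fun i => l (n - i)) (h := fun i => h (n - i)) hn
      (fun j _ _ => hlt _) (fun j hj hjn => hbl _ (by omega) (by omega))
      (fun j _ _ => hle _) (hpos _) h1'.1 h1'.2 (fun j hj hjn => ?_)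
      (fun i j hi hij hj ho => hN' (n - j) (n - i) (by omega) (by omega) (hover _ _ _ _ ho)) ?_ ?_,
      fun i j hij hj => ?_, fun i hi => ?_, fun i hi => ?_, ?_⟩
    · have := hX' (n - (j + 1))
      rw [show n - (j + 1) + 1 = n - j by omega] at this
      exact hover _ _ _ _ this
    · simp only [hnn]
      simp only [Overlap] at hno
      omega
    · simp only [hnn]
      simp only [Overlap] at hno
      omega
    · simp only [show j ≠ 0 by omega, if_false]
      split_ifs
      · exact hne _ _ (by omega) (by omega)
      · exact (hne _ _ (by omega) (by omega)).symm
    · split_ifs with h0 h2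
      · exact hinc0
      · exact (hinc _).2
      · exact (hinc _).1
    · split_ifs with h0
      · exact hincb
      · exact (hinc _).2
    · simp only [hn1, if_false]
      exact (hinc _).1

end RingStructure

section Positions

variable {Vm : Type*} {r : ℕ} {adj : Fin r → Vm → Prop}

/-- The fixed vertex at position `x` modulo `r`. -/
def cycPos (hr : 3 ≤ r) (x : ℕ) : Fin r :=
  ⟨x % r, Nat.mod_lt _ (by omega)⟩

theorem IncAt.adj_cycPos {x : ℕ} {w : Vm} (h : IncAt adj x w) (hr : 3 ≤ r) :
    adj (cycPos hr x) w := by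
  obtain ⟨i, hi, hx⟩ := h
  rwa [show cycPos hr x = i from Fin.ext hx.symm]

theorem IncAt.rotate {x y : ℕ} {w : Vm} (h : IncAt adj x w) (hr : 3 ≤ r) (k : Fin r)
    (hxy : x = y + k.val ∨ x + r = y + k.val) :
    IncAt (fun i w => adj (cycRot k i) w) y w := by
  refine ⟨cycPos hr y, ?_, rfl⟩
  convert h.adj_cycPos hr
  have hval : (cycRot k (cycPos hr y)).val = ((cycPos hr y).val + k.val) % r := by
    have := (cycPos hr y).isLt
    simp only [cycRot]
    split_ifs with h
    · rw [Nat.mod_eq_of_lt h]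
    · rw [Nat.mod_eq_sub_mod (by omega), Nat.mod_eq_of_lt (by omega)]
  apply Fin.ext
  rw [hval]
  simp only [cycPos, Nat.mod_add_mod]
  rcases hxy with h | h
  · rw [h]
  · rw [← h, Nat.add_mod_right]

/-- Two positions are joined by a walk whose vertices carry labels satisfying `T`, where `F` labels
the positions and `M` the mobile vertices. -/
def PosReach (hr : 3 ≤ r) (adj : Fin r → Vm → Prop) (F : ℕ → ℕ) (M : Vm → ℕ) (T : ℕ → Prop)
    (x y : ℕ) : Prop :=
  ReachIn (augmentedGraph r adj) (fun v => T (Sum.elim (fun i : Fin r => F i.val) M v))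
    (.inl (cycPos hr x)) (.inl (cycPos hr y))

namespace PosReach

variable {hr : 3 ≤ r} {F : ℕ → ℕ} {M : Vm → ℕ} {T : ℕ → Prop} {x y z : ℕ}

theorem symm (h : PosReach hr adj F M T x y) : PosReach hr adj F M T y x :=
  ReachIn.symm h

theorem trans (h : PosReach hr adj F M T x y) (h' : PosReach hr adj F M T y z) :
    PosReach hr adj F M T x z :=
  ReachIn.trans h h'

theorem arc_mod (hxy : x ≤ y) (h : ∀ k, x ≤ k → k ≤ y → T (F (k % r))) :
    PosReach hr adj F M T x y := by
  induction y, hxy using Nat.le_induction with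
  | base => exact ReachIn.refl (h x le_rfl le_rfl)
  | succ y hxy ih =>
    refine (ih fun k hk hk' => h k hk (by omega)).trans (ReachIn.of_adj
      (augmentedGraph_adj_inl hr ?_) (h y hxy (by omega)) (h (y + 1) (by omega) le_rfl))
    simp [cycPos]

theorem arc (hxy : x ≤ y) (hy : y < r) (h : ∀ k, x ≤ k → k ≤ y → T (F k)) :
    PosReach hr adj F M T x y :=
  arc_mod hxy fun k hk hk' => by
    rw [Nat.mod_eq_of_lt (by omega)]
    exact h k hk hk'

theorem arc_end (hx : x ≤ r) (h : ∀ k, x ≤ k → k < r → T (F k)) (h0 : T (F 0)) :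
    PosReach hr adj F M T x 0 := by
  have : PosReach hr adj F M T x r := arc_mod hx fun k hk hk' => by
    rcases hk'.eq_or_lt with rfl | hlt
    · simpa using h0
    · rw [Nat.mod_eq_of_lt hlt]
      exact h k hk hlt
  have he : cycPos hr 0 = cycPos hr r := by simp [cycPos]
  rw [PosReach, he]
  exact this

theorem mobile {w : Vm} (hx : IncAt adj x w) (hy : IncAt adj y w) (hFx : T (F (x % r)))
    (hFy : T (F (y % r))) (hw : T (M w)) : PosReach hr adj F M T x y :=
  reachIn_chord (hx.adj_cycPos hr) (hy.adj_cycPos hr) hFx hFy hw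

end PosReach

theorem KuratowskiPlanar.false_of_position_label (hr : 3 ≤ r)
    (hG : KuratowskiPlanar (augmentedGraph r adj)) (F : ℕ → ℕ) (M : Vm → ℕ) (A B : Fin 3 → ℕ)
    (hA : ∀ i, ∀ k < r, F k = 4 * i.val + 3 ↔ k = A i % r)
    (hB : ∀ j, ∀ k < r, F k = 12 + j.val ↔ k = B j % r)
    (hM : ∀ w, M w < 12 ∧ M w % 4 ≠ 3)
    (hp : ∀ i j : Fin 3, PosReach hr adj F M
      (fun t => t = 4 * i.val + 3 ∨ t = 12 + j.val ∨ t = 4 * i.val + j.val) (A i) (B j)) :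
    False := by
  refine hG.false_of_label_bipartite (Sum.elim (fun i : Fin r => F i.val) M)
    (fun i => .inl (cycPos hr (A i))) (fun j => .inl (cycPos hr (B j))) ?_ ?_ hp
  · rintro i (k | w)
    · simp [hA i k.val k.isLt, Fin.ext_iff, cycPos]
    · have := hM w
      simp
      omega
  · rintro i (k | w)
    · simp [hB i k.val k.isLt, Fin.ext_iff, cycPos]
    · have := hM w
      simp
      omega

end Positions

section LongRing

variable {Vm : Type*} {r n u : ℕ} {adj : Fin r → Vm → Prop} {l h : ℕ → ℕ} {c : ℕ → Vm}

theorem IsUnrolledRing.h_lt (H : IsUnrolledRing n r u l h) {i : ℕ} (hi : i + 3 ≤ n) :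
    h i < h (i + 1) :=
  (H.h_le_l i (by omega)).trans_lt (H.l_lt_h (i + 1) (by omega))

theorem IsUnrolledRing.h_mono (H : IsUnrolledRing n r u l h) {i j : ℕ} (hij : i ≤ j)
    (hj : j + 2 ≤ n) : h i ≤ h j := by
  induction j, hij using Nat.le_induction with
  | base => exact le_rfl
  | succ j hij ih => exact (ih (by omega)).trans (H.h_lt (by omega)).le

/-- The positions covered by the arcs from `h i` to `l (i + 2)` with `i ≥ 4` even. -/
def EvenArc (n : ℕ) (l h : ℕ → ℕ) (k : ℕ) : Prop :=
  ∃ i, 4 ≤ i ∧ i + 2 < n ∧ Even i ∧ h i ≤ k ∧ k ≤ l (i + 2)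

theorem IsUnrolledRing.not_evenArc (H : IsUnrolledRing n r u l h) {j k : ℕ} (hj : Odd j)
    (hjn : j + 2 ≤ n) (hk : h j ≤ k) (hk' : j + 2 < n → k ≤ l (j + 2)) : ¬ EvenArc n l h k := by
  rintro ⟨i, hi4, hin, hi, hik, hik'⟩
  rcases lt_trichotomy i j with hij | rfl | hij
  · have h1 := H.h_mono (show i + 1 ≤ j by omega) hjn
    have h2 : l (i + 2) < h (i + 1) := H.l_lt_h (i + 1) (by omega)
    omega
  · exact Nat.not_even_iff_odd.2 hj hi
  · have h1 := H.h_mono (show j + 1 ≤ i by omega) (by omega)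
    have h2 : l (j + 2) < h (j + 1) := H.l_lt_h (j + 1) (by omega)
    have := hk' (by omega)
    omega

/-- A labelling of the positions along a long ring whose first ends are the given numbers. -/
theorem exists_longLabel (E : Prop) {u l₁ h₀ l₂ h₁ l₃ h₂ l₄ h₃ l₅ h₄ : ℕ} (k : ℕ)
    (e₁ : 0 < u) (e₂ : u ≤ l₁) (e₃ : l₁ < h₀) (e₄ : h₀ ≤ l₂) (e₅ : l₂ < h₁) (e₆ : h₁ ≤ l₃)
    (e₇ : l₃ < h₂) (e₈ : h₂ ≤ l₄) (e₉ : l₄ < h₃) (e₁₀ : h₃ ≤ l₅) (e₁₁ : l₅ < h₄) : ∃ v : ℕ,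
    (v = 3 ↔ k = h₀) ∧ (v = 7 ↔ k = h₄) ∧ (v = 11 ↔ k = l₃) ∧ (v = 12 ↔ k = h₂) ∧
    (v = 13 ↔ k = l₁) ∧ (v = 14 ↔ k = l₅) ∧ (k = 0 → v = 2) ∧ (u ≤ k → k < l₁ → v = 5) ∧
    (l₁ < k → k < h₀ → v = 1) ∧ (h₀ < k → k ≤ l₂ → v = 0) ∧ (h₁ ≤ k → k < l₃ → v = 9) ∧
    (l₃ < k → k < h₂ → v = 8) ∧ (h₂ < k → k ≤ l₄ → v = 4) ∧ (h₃ ≤ k → k < l₅ → v = 10) ∧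
    (l₅ < k → k < h₄ → v = 6) ∧ (h₄ < k → E → v = 5) ∧ (h₄ < k → ¬ E → v = 2) := by
  have region : k = 0 ∨ 0 < k ∧ k < u ∨ u ≤ k ∧ k < l₁ ∨ k = l₁ ∨ l₁ < k ∧ k < h₀ ∨ k = h₀ ∨
      h₀ < k ∧ k ≤ l₂ ∨ l₂ < k ∧ k < h₁ ∨ h₁ ≤ k ∧ k < l₃ ∨ k = l₃ ∨ l₃ < k ∧ k < h₂ ∨
      k = h₂ ∨ h₂ < k ∧ k ≤ l₄ ∨ l₄ < k ∧ k < h₃ ∨ h₃ ≤ k ∧ k < l₅ ∨ k = l₅ ∨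
      l₅ < k ∧ k < h₄ ∨ k = h₄ ∨ h₄ < k := by
    omega
  rcases region with h | h | h | h | h | h | h | h | h | h | h | h | h | h | h | h | h | h | h
  · exact ⟨2, by omega⟩
  · exact ⟨15, by omega⟩
  · exact ⟨5, by omega⟩
  · exact ⟨13, by omega⟩
  · exact ⟨1, by omega⟩
  · exact ⟨3, by omega⟩
  · exact ⟨0, by omega⟩
  · exact ⟨15, by omega⟩
  · exact ⟨9, by omega⟩
  · exact ⟨11, by omega⟩
  · exact ⟨8, by omega⟩
  · exact ⟨12, by omega⟩
  · exact ⟨4, by omega⟩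
  · exact ⟨15, by omega⟩
  · exact ⟨10, by omega⟩
  · exact ⟨14, by omega⟩
  · exact ⟨6, by omega⟩
  · exact ⟨7, by omega⟩
  · by_cases hE : E
    · refine ⟨5, ?_, ?_, ?_, ?_, ?_, ?_, ?_, ?_, ?_, ?_, ?_, ?_, ?_, ?_, ?_, fun _ _ => rfl,
        fun _ h => absurd hE h⟩ <;> omega
    · refine ⟨2, ?_, ?_, ?_, ?_, ?_, ?_, ?_, ?_, ?_, ?_, ?_, ?_, ?_, ?_, ?_,
        fun _ h => absurd h hE, fun _ _ => rfl⟩ <;> omega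

/-- A labelling of the positions along a ring of length at least seven. -/
structure IsLongLabel (n u : ℕ) (l h F : ℕ → ℕ) : Prop where
  eq_three : ∀ k, F k = 3 ↔ k = h 0
  eq_seven : ∀ k, F k = 7 ↔ k = h 4
  eq_eleven : ∀ k, F k = 11 ↔ k = l 3
  eq_twelve : ∀ k, F k = 12 ↔ k = h 2
  eq_thirteen : ∀ k, F k = 13 ↔ k = l 1
  eq_fourteen : ∀ k, F k = 14 ↔ k = l 5
  zero : F 0 = 2
  u_l₁ : ∀ k, u ≤ k → k < l 1 → F k = 5
  l₁_h₀ : ∀ k, l 1 < k → k < h 0 → F k = 1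
  h₀_l₂ : ∀ k, h 0 < k → k ≤ l 2 → F k = 0
  h₁_l₃ : ∀ k, h 1 ≤ k → k < l 3 → F k = 9
  l₃_h₂ : ∀ k, l 3 < k → k < h 2 → F k = 8
  h₂_l₄ : ∀ k, h 2 < k → k ≤ l 4 → F k = 4
  h₃_l₅ : ∀ k, h 3 ≤ k → k < l 5 → F k = 10
  l₅_h₄ : ∀ k, l 5 < k → k < h 4 → F k = 6
  even : ∀ k, h 4 < k → EvenArc n l h k → F k = 5
  odd : ∀ k, h 4 < k → ¬ EvenArc n l h k → F k = 2

theorem IsUnrolledRing.exists_isLongLabel (H : IsUnrolledRing n r u l h) (hn : 7 ≤ n) :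
    ∃ F, IsLongLabel n u l h F := by
  choose F S using fun k => exists_longLabel (EvenArc n l h k) k H.u_pos H.u_le
    (H.l_lt_h 0 (by omega)) (H.h_le_l 0 (by omega)) (H.l_lt_h 1 (by omega)) (H.h_le_l 1 (by omega))
    (H.l_lt_h 2 (by omega)) (H.h_le_l 2 (by omega)) (H.l_lt_h 3 (by omega)) (H.h_le_l 3 (by omega))
    (H.l_lt_h 4 (by omega))
  choose S1 S2 S3 S4 S5 S6 S7 S8 S9 S10 S11 S12 S13 S14 S15 S16 S17 using S
  exact ⟨F, S1, S2, S3, S4, S5, S6, S7 0 rfl, S8, S9, S10, S11, S12, S13, S14, S15, S16, S17⟩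

/-- A labelling of the mobile vertices of a ring of length at least seven. -/
structure IsLongMobileLabel (n : ℕ) (c : ℕ → Vm) (M : Vm → ℕ) : Prop where
  zero : M (c 0) = 2
  one : M (c 1) = 9
  two : M (c 2) = 0
  three : M (c 3) = 10
  four : M (c 4) = 4
  even : ∀ j, 6 ≤ j → j < n → Even j → M (c j) = 5
  odd : ∀ j, 5 ≤ j → j < n → Odd j → M (c j) = 2
  range : ∀ w, M w < 12 ∧ M w % 4 ≠ 3

open Classical in
theorem IsRing.exists_isLongMobileLabel (H : IsRing n adj u l h c) (hn : 7 ≤ n) :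
    ∃ M, IsLongMobileLabel n c M := by
  set M : Vm → ℕ := fun w => if w = c 1 then 9 else if w = c 2 then 0 else if w = c 3 then 10 else
    if w = c 4 then 4 else if ∃ j, 6 ≤ j ∧ j < n ∧ Even j ∧ w = c j then 5 else 2 with hM
  have hMe : ∀ j, 6 ≤ j → j < n → Even j → M (c j) = 5 := by
    intro j hj hjn hje
    have h1 := H.ne 1 j (by omega) hjn
    have h2 := H.ne 2 j (by omega) hjn
    have h3 := H.ne 3 j (by omega) hjn
    have h4 := H.ne 4 j (by omega) hjn
    simp only [hM, h1.symm, h2.symm, h3.symm, h4.symm, if_false]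
    exact if_pos ⟨j, hj, hjn, hje, rfl⟩
  have hMo : ∀ j, 5 ≤ j → j < n → Odd j → M (c j) = 2 := by
    intro j hj hjn hjo
    have h1 := H.ne 1 j (by omega) hjn
    have h2 := H.ne 2 j (by omega) hjn
    have h3 := H.ne 3 j (by omega) hjn
    have h4 := H.ne 4 j (by omega) hjn
    simp only [hM, h1.symm, h2.symm, h3.symm, h4.symm, if_false]
    refine if_neg ?_
    rintro ⟨i, hi, hin, hie, hij⟩
    rcases lt_trichotomy i j with hlt | rfl | hlt
    · exact H.ne i j hlt hjn hij.symm
    · exact Nat.not_even_iff_odd.2 hjo hie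
    · exact H.ne j i hlt hin hij
  have hM0 : M (c 0) = 2 := by
    have h1 := H.ne 0 1 (by omega) (by omega)
    have h2 := H.ne 0 2 (by omega) (by omega)
    have h3 := H.ne 0 3 (by omega) (by omega)
    have h4 := H.ne 0 4 (by omega) (by omega)
    simp only [hM, h1, h2, h3, h4, if_false]
    refine if_neg ?_
    rintro ⟨i, hi, hin, hie, hij⟩
    exact H.ne 0 i (by omega) hin hij
  have hM1 : M (c 1) = 9 := by simp [hM]
  have hM2 : M (c 2) = 0 := by
    simp [hM, (H.ne 1 2 (by omega) (by omega)).symm]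
  have hM3 : M (c 3) = 10 := by
    simp [hM, (H.ne 1 3 (by omega) (by omega)).symm, (H.ne 2 3 (by omega) (by omega)).symm]
  have hM4 : M (c 4) = 4 := by
    simp [hM, (H.ne 1 4 (by omega) (by omega)).symm, (H.ne 2 4 (by omega) (by omega)).symm,
      (H.ne 3 4 (by omega) (by omega)).symm]
  refine ⟨M, hM0, hM1, hM2, hM3, hM4, hMe, hMo, fun w => ?_⟩
  simp only [hM]
  split_ifs <;> simp

theorem IsLongLabel.evenArc {F : ℕ → ℕ} (S : IsLongLabel n u l h F) (H : IsUnrolledRing n r u l h)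
    {i k : ℕ} (hi : 4 ≤ i) (hin : i + 2 < n) (hie : Even i) (hk : h i ≤ k) (hk' : k ≤ l (i + 2)) :
    F k = 7 ∨ F k = 5 := by
  have h1 := H.h_mono hi hin.le
  by_cases hk4 : k = h 4
  · exact .inl ((S.eq_seven k).2 hk4)
  · exact .inr (S.even k (by omega) ⟨i, hi, hin, hie, hk, hk'⟩)

theorem IsLongLabel.oddArc {F : ℕ → ℕ} (S : IsLongLabel n u l h F) (H : IsUnrolledRing n r u l h)
    {i k : ℕ} (hi : 5 ≤ i) (hin : i + 2 ≤ n) (hio : Odd i) (hk : h i ≤ k)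
    (hk' : i + 2 < n → k ≤ l (i + 2)) : F k = 2 := by
  have h1 := H.h_mono hi hin
  have h2 : h 4 < h 5 := H.h_lt (by omega)
  exact S.odd k (by omega) (H.not_evenArc hio hin hk hk')

theorem IsUnrolledRing.h_le_r (H : IsUnrolledRing n r u l h) {i : ℕ} (hi : i + 2 ≤ n) : h i ≤ r :=
  (H.h_mono (show i ≤ n - 2 by omega) (by omega)).trans H.h_le

theorem IsUnrolledRing.h_lt_r (H : IsUnrolledRing n r u l h) {i : ℕ} (hi : i + 3 ≤ n) : h i < r :=
  (H.h_lt hi).trans_le (H.h_le_r (by omega))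

theorem IsUnrolledRing.l_lt_r (H : IsUnrolledRing n r u l h) {i : ℕ} (hi : i + 1 < n) :
    l (i + 1) < r :=
  (H.l_lt_h i hi).trans_le (H.h_le_r (by omega))

theorem IsRing.posReach_even {F : ℕ → ℕ} {M : Vm → ℕ} (H : IsRing n adj u l h c) (hr : 3 ≤ r)
    (S : IsLongLabel n u l h F) (N : IsLongMobileLabel n c M) : ∀ k j, j + 2 * k + 3 = n → 4 ≤ j →
    Even j → PosReach hr adj F M (fun t => t = 7 ∨ t = 13 ∨ t = 5) (h j) (l 1) := by
  intro k
  induction k with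
  | zero =>
    intro j hj hj4 hje
    have hlast : n - 1 = j + 1 + 1 := by omega
    have a1 : PosReach hr adj F M (fun t => t = 7 ∨ t = 13 ∨ t = 5) (h j) (l (j + 2)) :=
      .arc (H.h_le_l j (by omega)) (H.l_lt_r (by omega)) fun k hk hk' => by
        rcases S.evenArc H.toIsUnrolledRing hj4 (by omega) hje hk hk'
        with h | h <;> simp [h]
    have a2 : PosReach hr adj F M (fun t => t = 7 ∨ t = 13 ∨ t = 5) u (l 1) :=
      .arc H.u_le (H.l_lt_r (i := 0) (by omega)) fun k hk hk' => by
        rcases hk'.eq_or_lt with rfl | hlt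
        · exact .inr (.inl ((S.eq_thirteen _).2 rfl))
        · exact .inr (.inr (S.u_l₁ k hk hlt))
    have hu := H.inc_u
    rw [hlast] at hu
    refine a1.trans (.trans (.mobile (H.inc_l (j + 2) (by omega)) hu ?_ ?_ ?_) a2)
    · rw [Nat.mod_eq_of_lt (H.l_lt_r (by omega))]
      rcases S.evenArc H.toIsUnrolledRing hj4 (by omega) hje (H.h_le_l j (by omega)) le_rfl
        with h | h <;> simp [h]
    · rw [Nat.mod_eq_of_lt (H.u_le.trans_lt (H.l_lt_r (by omega)))]
      rcases H.u_le.eq_or_lt with heq | hlt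
      · exact .inr (.inl ((S.eq_thirteen _).2 heq))
      · exact .inr (.inr (S.u_l₁ u le_rfl hlt))
    · exact .inr (.inr (N.even (j + 2) (by omega) (by omega) (by simpa [Nat.even_add] using hje)))
  | succ k ih =>
    intro j hj hj4 hje
    have hje' : Even (j + 2) := by simpa [Nat.even_add] using hje
    have a1 : PosReach hr adj F M (fun t => t = 7 ∨ t = 13 ∨ t = 5) (h j) (l (j + 2)) :=
      .arc (H.h_le_l j (by omega)) (H.l_lt_r (by omega)) fun k hk hk' => by
        rcases S.evenArc H.toIsUnrolledRing hj4 (by omega) hje hk hk'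
        with h | h <;> simp [h]
    refine a1.trans (.trans (.mobile (H.inc_l (j + 2) (by omega)) (H.inc_h (j + 2) (by omega))
      ?_ ?_ ?_) (ih (j + 2) (by omega) (by omega) hje'))
    · rw [Nat.mod_eq_of_lt (H.l_lt_r (by omega))]
      rcases S.evenArc H.toIsUnrolledRing hj4 (by omega) hje (H.h_le_l j (by omega)) le_rfl
        with h | h <;> simp [h]
    · rw [Nat.mod_eq_of_lt (H.h_lt_r (by omega))]
      rcases S.evenArc H.toIsUnrolledRing (i := j + 2) (by omega) (by omega) hje' le_rfl
          (H.h_le_l (j + 2) (by omega))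

        with h | h <;> simp [h]
    · exact .inr (.inr (N.even (j + 2) (by omega) (by omega) hje'))

theorem IsRing.posReach_odd {F : ℕ → ℕ} {M : Vm → ℕ} (H : IsRing n adj u l h c) (hr : 3 ≤ r)
    (S : IsLongLabel n u l h F) (N : IsLongMobileLabel n c M) : ∀ k j, j + 2 * k + 2 = n → 5 ≤ j →
    Odd j → PosReach hr adj F M (fun t => t = 3 ∨ t = 14 ∨ t = 2) (h j) (h 0) := by
  intro k
  induction k with
  | zero =>
    intro j hj hj5 hjo
    have a1 : PosReach hr adj F M (fun t => t = 3 ∨ t = 14 ∨ t = 2) (h j) 0 :=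
      .arc_end (H.h_le_r (by omega)) (fun k hk _ =>
        .inr (.inr (S.oddArc H.toIsUnrolledRing hj5 (by omega) hjo hk (by omega))))
            (.inr (.inr S.zero))
    have hi := H.inc_l 0 (by omega)
    rw [H.l_zero] at hi
    refine a1.trans (.mobile hi (H.inc_h 0 (by omega)) ?_ ?_ ?_)
    · simp [S.zero]
    · rw [Nat.mod_eq_of_lt (H.h_lt_r (by omega))]
      exact .inl ((S.eq_three _).2 rfl)
    · exact .inr (.inr N.zero)
  | succ k ih =>
    intro j hj hj5 hjo
    have hjo' : Odd (j + 2) := by simpa [Nat.odd_add] using hjo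
    have a1 : PosReach hr adj F M (fun t => t = 3 ∨ t = 14 ∨ t = 2) (h j) (l (j + 2)) :=
      .arc (H.h_le_l j (by omega)) (H.l_lt_r (by omega)) fun k hk hk' =>
        .inr (.inr (S.oddArc H.toIsUnrolledRing hj5 (by omega) hjo hk fun _ => hk'))
    refine a1.trans (.trans (.mobile (H.inc_l (j + 2) (by omega)) (H.inc_h (j + 2) (by omega))
      ?_ ?_ ?_) (ih (j + 2) (by omega) (by omega) hjo'))
    · rw [Nat.mod_eq_of_lt (H.l_lt_r (by omega))]
      exact .inr (.inr (S.oddArc H.toIsUnrolledRing hj5 (by omega) hjo (H.h_le_l j (by omega))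
          fun _ => le_rfl))
    · obtain hlt | heq := (H.h_le_r (i := j + 2) (by omega)).lt_or_eq
      · rw [Nat.mod_eq_of_lt hlt]
        exact .inr (.inr (S.oddArc H.toIsUnrolledRing (i := j + 2) (by omega) (by omega) hjo' le_rfl
          fun hj => H.h_le_l (j + 2) hj))
      · simp [heq, S.zero]
    · exact .inr (.inr (N.odd (j + 2) (by omega) (by omega) hjo'))

/-- A ring of odd length at least seven contains a subdivided `K₃,₃`. -/
theorem IsRing.false_of_seven_le (H : IsRing n adj u l h c) (hr : 3 ≤ r) (hn : 7 ≤ n)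
    (hodd : Odd n) (hG : KuratowskiPlanar (augmentedGraph r adj)) : False := by
  obtain ⟨m, hm⟩ := hodd
  obtain ⟨F, S⟩ := H.exists_isLongLabel hn
  obtain ⟨M, N⟩ := H.exists_isLongMobileLabel hn
  have lr : ∀ i, 1 ≤ i → i < n → l i < r := fun i hi hin => by
    obtain ⟨i, rfl⟩ := Nat.exists_eq_add_of_le' hi
    exact H.l_lt_r hin
  have hr' : ∀ i, i + 3 ≤ n → h i < r := fun i => H.h_lt_r
  have e3 : l 1 < h 0 := H.l_lt_h 0 (by omega)
  have e4 : h 0 ≤ l 2 := H.h_le_l 0 (by omega)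
  have e5 : l 2 < h 1 := H.l_lt_h 1 (by omega)
  have e6 : h 1 ≤ l 3 := H.h_le_l 1 (by omega)
  have e7 : l 3 < h 2 := H.l_lt_h 2 (by omega)
  have e8 : h 2 ≤ l 4 := H.h_le_l 2 (by omega)
  have e9 : l 4 < h 3 := H.l_lt_h 3 (by omega)
  have e10 : h 3 ≤ l 5 := H.h_le_l 3 (by omega)
  have e11 : l 5 < h 4 := H.l_lt_h 4 (by omega)
  have chord : ∀ {T : ℕ → Prop} i, 1 ≤ i → i + 2 ≤ n → T (F (l i)) → T (F (h i % r)) →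
      T (M (c i)) → PosReach hr adj F M T (l i) (h i) := by
    intro T i hi hin t1 t2 t3
    refine .mobile (H.inc_l i (by omega)) (H.inc_h i (by omega)) ?_ t2 t3
    rwa [Nat.mod_eq_of_lt (lr i hi (by omega))]
  have f3 := (S.eq_three _).2 rfl
  have f7 := (S.eq_seven _).2 rfl
  have f11 := (S.eq_eleven _).2 rfl
  have f12 := (S.eq_twelve _).2 rfl
  have f13 := (S.eq_thirteen _).2 rfl
  have f14 := (S.eq_fourteen _).2 rfl
  have A00 : ∀ k, h 0 ≤ k → k ≤ l 2 → F k = 3 ∨ F k = 12 ∨ F k = 0 := fun k hk hk' => by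
    rcases hk.eq_or_lt with rfl | hlt
    exacts [.inl f3, .inr (.inr (S.h₀_l₂ k hlt hk'))]
  have A01 : ∀ k, l 1 ≤ k → k ≤ h 0 → F k = 3 ∨ F k = 13 ∨ F k = 1 := fun k hk hk' => by
    rcases hk.eq_or_lt with rfl | hlt
    · exact .inr (.inl f13)
    · rcases hk'.eq_or_lt with rfl | hlt'
      exacts [.inl f3, .inr (.inr (S.l₁_h₀ k hlt hlt'))]
  have A10 : ∀ k, h 2 ≤ k → k ≤ l 4 → F k = 7 ∨ F k = 12 ∨ F k = 4 := fun k hk hk' => by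
    rcases hk.eq_or_lt with rfl | hlt
    exacts [.inr (.inl f12), .inr (.inr (S.h₂_l₄ k hlt hk'))]
  have A12 : ∀ k, l 5 ≤ k → k ≤ h 4 → F k = 7 ∨ F k = 14 ∨ F k = 6 := fun k hk hk' => by
    rcases hk.eq_or_lt with rfl | hlt
    · exact .inr (.inl f14)
    · rcases hk'.eq_or_lt with rfl | hlt'
      exacts [.inl f7, .inr (.inr (S.l₅_h₄ k hlt hlt'))]
  have A20 : ∀ k, l 3 ≤ k → k ≤ h 2 → F k = 11 ∨ F k = 12 ∨ F k = 8 := fun k hk hk' => by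
    rcases hk.eq_or_lt with rfl | hlt
    · exact .inl f11
    · rcases hk'.eq_or_lt with rfl | hlt'
      exacts [.inr (.inl f12), .inr (.inr (S.l₃_h₂ k hlt hlt'))]
  have A21 : ∀ k, h 1 ≤ k → k ≤ l 3 → F k = 11 ∨ F k = 13 ∨ F k = 9 := fun k hk hk' => by
    rcases hk'.eq_or_lt with rfl | hlt'
    exacts [.inl f11, .inr (.inr (S.h₁_l₃ k hk hlt'))]
  have A22 : ∀ k, h 3 ≤ k → k ≤ l 5 → F k = 11 ∨ F k = 14 ∨ F k = 10 := fun k hk hk' => by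
    rcases hk'.eq_or_lt with rfl | hlt'
    exacts [.inr (.inl f14), .inr (.inr (S.h₃_l₅ k hk hlt'))]
  have f5 : F (h 5 % r) = 2 := by
    rcases (H.h_le_r (i := 5) (by omega)).eq_or_lt with heq | hlt
    · rw [heq, Nat.mod_self]
      exact S.zero
    · rw [Nat.mod_eq_of_lt hlt]
      exact S.oddArc H.toIsUnrolledRing le_rfl (by omega) ⟨2, rfl⟩ le_rfl fun hj => H.h_le_l 5 hj
  refine hG.false_of_position_label hr F M ![h 0, h 4, l 3] ![h 2, l 1, l 5] ?_ ?_ N.range ?_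
  · intro i k hk
    fin_cases i
    · exact (S.eq_three k).trans (.of_eq (congrArg (k = ·)
        (Nat.mod_eq_of_lt (hr' 0 (by omega))).symm))
    · exact (S.eq_seven k).trans (.of_eq (congrArg (k = ·)
        (Nat.mod_eq_of_lt (hr' 4 (by omega))).symm))
    · exact (S.eq_eleven k).trans (.of_eq (congrArg (k = ·)
        (Nat.mod_eq_of_lt (lr 3 (by omega) (by omega))).symm))
  · intro i k hk
    fin_cases i
    · exact (S.eq_twelve k).trans (.of_eq (congrArg (k = ·)
        (Nat.mod_eq_of_lt (hr' 2 (by omega))).symm))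
    · exact (S.eq_thirteen k).trans (.of_eq (congrArg (k = ·)
        (Nat.mod_eq_of_lt (lr 1 (by omega) (by omega))).symm))
    · exact (S.eq_fourteen k).trans (.of_eq (congrArg (k = ·)
        (Nat.mod_eq_of_lt (lr 5 (by omega) (by omega))).symm))
  · have P00 : PosReach hr adj F M (fun t => t = 3 ∨ t = 12 ∨ t = 0) (h 0) (h 2) := by
      refine .trans (.arc e4 (lr 2 (by omega) (by omega)) A00) (chord 2 (by omega) (by omega)
        (A00 _ e4 le_rfl) ?_ (.inr (.inr N.two)))
      rw [Nat.mod_eq_of_lt (hr' 2 (by omega))]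
      exact .inr (.inl f12)
    have P01 : PosReach hr adj F M (fun t => t = 3 ∨ t = 13 ∨ t = 1) (h 0) (l 1) :=
      (PosReach.arc e3.le (hr' 0 (by omega)) A01).symm
    have P02 : PosReach hr adj F M (fun t => t = 3 ∨ t = 14 ∨ t = 2) (h 0) (l 5) :=
      ((chord 5 (by omega) (by omega) (.inr (.inl f14)) (.inr (.inr f5))
        (.inr (.inr (N.odd 5 le_rfl (by omega) ⟨2, rfl⟩)))).trans
        (H.posReach_odd hr S N (m - 3) 5 (by omega) le_rfl ⟨2, rfl⟩)).symm
    have P10 : PosReach hr adj F M (fun t => t = 7 ∨ t = 12 ∨ t = 4) (h 4) (h 2) := by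
      refine (PosReach.trans (.arc e8 (lr 4 (by omega) (by omega)) A10) (chord 4 (by omega)
        (by omega) (A10 _ e8 le_rfl) ?_ (.inr (.inr N.four)))).symm
      rw [Nat.mod_eq_of_lt (hr' 4 (by omega))]
      exact .inl f7
    have P11 : PosReach hr adj F M (fun t => t = 7 ∨ t = 13 ∨ t = 5) (h 4) (l 1) :=
      H.posReach_even hr S N (m - 3) 4 (by omega) le_rfl ⟨2, rfl⟩
    have P12 : PosReach hr adj F M (fun t => t = 7 ∨ t = 14 ∨ t = 6) (h 4) (l 5) :=
      (PosReach.arc e11.le (hr' 4 (by omega)) A12).symm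
    have P20 : PosReach hr adj F M (fun t => t = 11 ∨ t = 12 ∨ t = 8) (l 3) (h 2) :=
      .arc e7.le (hr' 2 (by omega)) A20
    have P21 : PosReach hr adj F M (fun t => t = 11 ∨ t = 13 ∨ t = 9) (l 3) (l 1) := by
      refine (PosReach.trans (chord 1 le_rfl (by omega) (.inr (.inl f13)) ?_ (.inr (.inr N.one)))
        (.arc e6 (lr 3 (by omega) (by omega)) A21)).symm
      rw [Nat.mod_eq_of_lt (hr' 1 (by omega))]
      exact A21 _ le_rfl e6
    have P22 : PosReach hr adj F M (fun t => t = 11 ∨ t = 14 ∨ t = 10) (l 3) (l 5) := by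
      refine .trans (chord 3 (by omega) (by omega) (.inl f11) ?_ (.inr (.inr N.three)))
        (.arc e10 (lr 5 (by omega) (by omega)) A22)
      rw [Nat.mod_eq_of_lt (hr' 3 (by omega))]
      exact A22 _ le_rfl e10
    intro i j
    fin_cases i <;> fin_cases j
    exacts [P00, P01, P02, P10, P11, P12, P20, P21, P22]

end LongRing

section ShortRing

variable {Vm : Type*} {r u : ℕ} {adj : Fin r → Vm → Prop} {l h : ℕ → ℕ} {c : ℕ → Vm}

/-- A labelling of the positions along a ring of length five with `h 0 < l 2`. -/
theorem exists_shortLabel {l₁ h₀ l₂ h₁ l₃ h₂ l₄ h₃ e : ℕ} (k : ℕ) (e₁ : 0 < u) (e₂ : u ≤ l₁)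
    (e₃ : l₁ < h₀) (e₄ : h₀ < l₂) (e₅ : l₂ < h₁) (e₆ : h₁ ≤ l₃) (e₇ : l₃ < h₂) (e₈ : h₂ ≤ l₄)
    (e₉ : l₄ < h₃) (e₁₀ : h₃ ≤ r) (he : h₃ < r ∧ e = h₃ ∨ h₃ = r ∧ e = 0) : ∃ v : ℕ, k < r →
    (v = 3 ↔ k = h₀) ∧ (v = 7 ↔ k = l₄) ∧ (v = 11 ↔ k = h₁) ∧ (v = 12 ↔ k = l₂) ∧
    (v = 13 ↔ k = l₁) ∧ (v = 14 ↔ k = e) ∧ (k = 0 → v = 2 ∨ v = 14) ∧ (u ≤ k → k < l₁ → v = 5) ∧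
    (l₁ < k → k < h₀ → v = 1) ∧ (h₀ < k → k < l₂ → v = 0) ∧ (h₁ < k → k ≤ l₃ → v = 10) ∧
    (l₂ < k → k < h₁ → v = 8) ∧ (h₂ ≤ k → k < l₄ → v = 4) ∧ (l₄ < k → k < h₃ → v = 6) ∧
    (h₃ < k → v = 2) := by
  have region : k = 0 ∧ h₃ = r ∨ k = 0 ∧ h₃ < r ∨ 0 < k ∧ k < u ∨ u ≤ k ∧ k < l₁ ∨ k = l₁ ∨
      l₁ < k ∧ k < h₀ ∨ k = h₀ ∨ h₀ < k ∧ k < l₂ ∨ k = l₂ ∨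
      l₂ < k ∧ k < h₁ ∨ k = h₁ ∨ h₁ < k ∧ k ≤ l₃ ∨ l₃ < k ∧ k < h₂ ∨
      h₂ ≤ k ∧ k < l₄ ∨ k = l₄ ∨ l₄ < k ∧ k < h₃ ∨ k = h₃ ∨ h₃ < k := by
    omega
  rcases region with h | h | h | h | h | h | h | h | h | h | h | h | h | h | h | h | h | h
  · exact ⟨14, by omega⟩
  · exact ⟨2, by omega⟩
  · exact ⟨15, by omega⟩
  · exact ⟨5, by omega⟩
  · exact ⟨13, by omega⟩
  · exact ⟨1, by omega⟩
  · exact ⟨3, by omega⟩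
  · exact ⟨0, by omega⟩
  · exact ⟨12, by omega⟩
  · exact ⟨8, by omega⟩
  · exact ⟨11, by omega⟩
  · exact ⟨10, by omega⟩
  · exact ⟨15, by omega⟩
  · exact ⟨4, by omega⟩
  · exact ⟨7, by omega⟩
  · exact ⟨6, by omega⟩
  · exact ⟨14, by omega⟩
  · exact ⟨2, by omega⟩

open Classical in
/-- A labelling of the mobile vertices of a ring of length five. -/
theorem IsRing.exists_shortMobileLabel (H : IsRing 5 adj u l h c) : ∃ M : Vm → ℕ, M (c 0) = 2 ∧
    M (c 1) = 9 ∧ M (c 2) = 4 ∧ M (c 3) = 10 ∧ M (c 4) = 5 ∧ ∀ w, M w < 12 ∧ M w % 4 ≠ 3 := by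
  refine ⟨fun w => if w = c 1 then 9 else if w = c 2 then 4 else if w = c 3 then 10 else
    if w = c 4 then 5 else 2, ?_, ?_, ?_, ?_, ?_, fun w => ?_⟩
  · simp [H.ne 0 1, H.ne 0 2, H.ne 0 3, H.ne 0 4]
  · simp
  · simp [(H.ne 1 2 (by omega) (by omega)).symm]
  · simp [(H.ne 1 3 (by omega) (by omega)).symm, (H.ne 2 3 (by omega) (by omega)).symm]
  · simp [(H.ne 1 4 (by omega) (by omega)).symm, (H.ne 2 4 (by omega) (by omega)).symm,
      (H.ne 3 4 (by omega) (by omega)).symm]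
  · dsimp only
    split_ifs <;> simp

theorem IsUnrolledRing.l_mono {n : ℕ} (H : IsUnrolledRing n r u l h) {i j : ℕ} (hij : i ≤ j)
    (hj : j < n) : l i ≤ l j := by
  induction j, hij using Nat.le_induction with
  | base => exact le_rfl
  | succ j hij ih => exact (ih (by omega)).trans (H.l_lt_l j hj).le

theorem IsRing.h_zero_eq (H : IsRing 5 adj u l h c) (hr : 3 ≤ r)
    (hG : KuratowskiPlanar (augmentedGraph r adj)) : h 0 = l 2 := by
  by_contra hne
  have e1 := H.u_pos
  have e2 := H.u_le
  have e3 : l 1 < h 0 := H.l_lt_h 0 (by omega)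
  have e4 : h 0 < l 2 := lt_of_le_of_ne (H.h_le_l 0 (by omega)) hne
  have e5 : l 2 < h 1 := H.l_lt_h 1 (by omega)
  have e6 : h 1 ≤ l 3 := H.h_le_l 1 (by omega)
  have e7 : l 3 < h 2 := H.l_lt_h 2 (by omega)
  have e8 : h 2 ≤ l 4 := H.h_le_l 2 (by omega)
  have e9 : l 4 < h 3 := H.l_lt_h 3 (by omega)
  have e10 : h 3 ≤ r := H.h_le
  have he : h 3 < r ∧ h 3 % r = h 3 ∨ h 3 = r ∧ h 3 % r = 0 := by
    rcases e10.eq_or_lt with heq | hlt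
    · exact .inr ⟨heq, by rw [heq, Nat.mod_self]⟩
    · exact .inl ⟨hlt, Nat.mod_eq_of_lt hlt⟩
  have hl0 := H.l_zero
  have hmod : ∀ x, x < r → x % r = x := fun x => Nat.mod_eq_of_lt
  obtain ⟨M, M0, M1, M2, M3, M4, hM⟩ := H.exists_shortMobileLabel
  choose F S using fun k => exists_shortLabel (r := r) k e1 e2 e3 e4 e5 e6 e7 e8 e9 e10 he
  refine hG.false_of_position_label hr F M ![h 0, l 4, h 1] ![l 2, l 1, h 3] ?_ ?_ hM ?_
  · intro i k hk
    have := S k hk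
    fin_cases i
    · exact this.1.trans (.of_eq (congrArg (k = ·) (hmod _ (by omega)).symm))
    · exact this.2.1.trans (.of_eq (congrArg (k = ·) (hmod _ (by omega)).symm))
    · exact this.2.2.1.trans (.of_eq (congrArg (k = ·) (hmod _ (by omega)).symm))
  · intro i k hk
    have := S k hk
    fin_cases i
    · exact this.2.2.2.1.trans (.of_eq (congrArg (k = ·) (hmod _ (by omega)).symm))
    · exact this.2.2.2.2.1.trans (.of_eq (congrArg (k = ·) (hmod _ (by omega)).symm))
    · exact this.2.2.2.2.2.1
  · have A00 : ∀ k, h 0 ≤ k → k ≤ l 2 → F k = 3 ∨ F k = 12 ∨ F k = 0 := fun k hk hk' => by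
      have := S k (by omega)
      omega
    have A01 : ∀ k, l 1 ≤ k → k ≤ h 0 → F k = 3 ∨ F k = 13 ∨ F k = 1 := fun k hk hk' => by
      have := S k (by omega)
      omega
    have A02 : ∀ k, h 3 ≤ k → k < r → F k = 3 ∨ F k = 14 ∨ F k = 2 := fun k hk hk' => by
      have := S k (by omega)
      omega
    have A02' : F 0 = 3 ∨ F 0 = 14 ∨ F 0 = 2 := by
      have := S 0 (by omega)
      omega
    have A10 : ∀ k, h 2 ≤ k → k ≤ l 4 → F k = 7 ∨ F k = 12 ∨ F k = 4 := fun k hk hk' => by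
      have := S k (by omega)
      omega
    have A11 : ∀ k, u ≤ k → k ≤ l 1 → F k = 7 ∨ F k = 13 ∨ F k = 5 := fun k hk hk' => by
      have := S k (by omega)
      omega
    have A12 : ∀ k, l 4 ≤ k → k < h 3 → F k = 7 ∨ F k = 14 ∨ F k = 6 := fun k hk hk' => by
      have := S k (by omega)
      omega
    have A20 : ∀ k, l 2 ≤ k → k ≤ h 1 → F k = 11 ∨ F k = 12 ∨ F k = 8 := fun k hk hk' => by
      have := S k (by omega)
      omega
    have A22 : ∀ k, h 1 ≤ k → k ≤ l 3 → F k = 11 ∨ F k = 14 ∨ F k = 10 := fun k hk hk' => by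
      have := S k (by omega)
      omega
    have f1 : F (l 1) = 13 := by
      have := S (l 1) (by omega)
      omega
    have f2 : F (l 2) = 12 := by
      have := S (l 2) (by omega)
      omega
    have f4 : F (l 4) = 7 := by
      have := S (l 4) (by omega)
      omega
    have g0 : F (h 0) = 3 := by
      have := S (h 0) (by omega)
      omega
    have g1 : F (h 1) = 11 := by
      have := S (h 1) (by omega)
      omega
    have g3 : F (h 3 % r) = 14 := by
      have := S (h 3 % r) (Nat.mod_lt _ (by omega))
      omega
    clear S
    have P00 : PosReach hr adj F M (fun t => t = 3 ∨ t = 12 ∨ t = 0) (h 0) (l 2) :=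
      .arc e4.le (by omega) A00
    have P01 : PosReach hr adj F M (fun t => t = 3 ∨ t = 13 ∨ t = 1) (h 0) (l 1) :=
      (PosReach.arc e3.le (by omega) A01).symm
    have P02 : PosReach hr adj F M (fun t => t = 3 ∨ t = 14 ∨ t = 2) (h 0) (h 3) := by
      have hi := H.inc_l 0 (by omega)
      rw [hl0] at hi
      refine (PosReach.trans (.arc_end e10 A02 A02') (.mobile hi (H.inc_h 0 (by omega)) ?_ ?_
        (.inr (.inr M0)))).symm
      · rwa [Nat.zero_mod]
      · rw [hmod _ (by omega)]
        exact .inl g0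
    have P10 : PosReach hr adj F M (fun t => t = 7 ∨ t = 12 ∨ t = 4) (l 4) (l 2) := by
      refine (PosReach.trans (.mobile (H.inc_l 2 (by omega)) (H.inc_h 2 (by omega)) ?_ ?_
        (.inr (.inr M2))) (.arc e8 (by omega) A10)).symm
      · rw [hmod _ (by omega)]
        exact .inr (.inl f2)
      · rw [hmod _ (by omega)]
        exact A10 _ le_rfl e8
    have P11 : PosReach hr adj F M (fun t => t = 7 ∨ t = 13 ∨ t = 5) (l 4) (l 1) := by
      refine .trans (.mobile (H.inc_l 4 (by omega)) H.inc_u ?_ ?_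
        (.inr (.inr M4))) (.arc e2 (by omega) A11)
      · rw [hmod _ (by omega)]
        exact .inl f4
      · rw [hmod _ (by omega)]
        exact A11 _ le_rfl e2
    have P12 : PosReach hr adj F M (fun t => t = 7 ∨ t = 14 ∨ t = 6) (l 4) (h 3) :=
      .arc_mod e9.le fun k hk hk' => by
        rcases hk'.eq_or_lt with rfl | hlt
        · exact .inr (.inl g3)
        · rw [hmod _ (by omega)]
          exact A12 k hk hlt
    have P20 : PosReach hr adj F M (fun t => t = 11 ∨ t = 12 ∨ t = 8) (h 1) (l 2) :=
      (PosReach.arc e5.le (by omega) A20).symm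
    have P21 : PosReach hr adj F M (fun t => t = 11 ∨ t = 13 ∨ t = 9) (h 1) (l 1) := by
      refine (PosReach.mobile (H.inc_l 1 (by omega)) (H.inc_h 1 (by omega)) ?_ ?_
        (.inr (.inr M1))).symm
      · rw [hmod _ (by omega)]
        exact .inr (.inl f1)
      · rw [hmod _ (by omega)]
        exact .inl g1
    have P22 : PosReach hr adj F M (fun t => t = 11 ∨ t = 14 ∨ t = 10) (h 1) (h 3) := by
      refine .trans (.arc e6 (by omega) A22) (.mobile (H.inc_l 3 (by omega))
        (H.inc_h 3 (by omega)) ?_ (.inr (.inl g3)) (.inr (.inr M3)))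
      rw [hmod _ (by omega)]
      exact A22 _ e6 le_rfl
    intro i j
    fin_cases i <;> fin_cases j
    exacts [P00, P01, P02, P10, P11, P12, P20, P21, P22]

/-- Cutting the cycle open at the first end of chord `1` instead of chord `0`. -/
theorem IsRing.shift (H : IsRing 5 adj u l h c) (hr : 3 ≤ r) :
    ∃ l' h' : ℕ → ℕ, ∃ c' : ℕ → Vm,
      IsRing 5 (fun i w => adj (cycRot (cycPos hr (l 1)) i) w) (h 0 - l 1) l' h' c' ∧
      l' 1 = l 2 - l 1 ∧ l' 2 = l 3 - l 1 ∧ l' 3 = l 4 - l 1 ∧ l' 4 = r - l 1 ∧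
      h' 0 = h 1 - l 1 ∧ h' 1 = h 2 - l 1 ∧ h' 2 = h 3 - l 1 ∧ h' 3 = u + r - l 1 := by
  have e1 := H.u_pos
  have e2 := H.u_le
  have e3 : l 1 < h 0 := H.l_lt_h 0 (by omega)
  have e4 : h 0 ≤ l 2 := H.h_le_l 0 (by omega)
  have e5 : l 2 < h 1 := H.l_lt_h 1 (by omega)
  have e6 : h 1 ≤ l 3 := H.h_le_l 1 (by omega)
  have e7 : l 3 < h 2 := H.l_lt_h 2 (by omega)
  have e8 : h 2 ≤ l 4 := H.h_le_l 2 (by omega)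
  have e9 : l 4 < h 3 := H.l_lt_h 3 (by omega)
  have e10 : h 3 ≤ r := H.h_le
  have hl0 := H.l_zero
  have hk : (cycPos hr (l 1)).val = l 1 := Nat.mod_eq_of_lt (by omega)
  have rot : ∀ {x y : ℕ} {w : Vm}, IncAt adj x w → x = y + l 1 ∨ x + r = y + l 1 →
      IncAt (fun i w => adj (cycRot (cycPos hr (l 1)) i) w) y w := fun h hxy =>
    h.rotate hr _ (by rwa [hk])
  refine ⟨fun i => if i = 4 then r - l 1 else l (i + 1) - l 1,
    fun i => if i = 3 then u + r - l 1 else h (i + 1) - l 1,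
    fun i => if i = 4 then c 0 else c (i + 1), ⟨⟨?_, ?_, ?_, ?_, ?_, ?_, ?_⟩, ?_, ?_, ?_, ?_⟩,
    rfl, rfl, rfl, rfl, rfl, rfl, rfl, rfl⟩
  · simp
  · intro i hi
    obtain rfl | rfl | rfl | rfl : i = 0 ∨ i = 1 ∨ i = 2 ∨ i = 3 := by omega
    all_goals (simp; omega)
  · intro i hi
    obtain rfl | rfl | rfl | rfl : i = 0 ∨ i = 1 ∨ i = 2 ∨ i = 3 := by omega
    all_goals (simp; omega)
  · intro i hi
    obtain rfl | rfl | rfl : i = 0 ∨ i = 1 ∨ i = 2 := by omega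
    all_goals (simp; omega)
  · simp
    omega
  · omega
  · simp
    omega
  · intro i j hij hj
    have hne := H.ne
    by_cases hj4 : j = 4
    · simpa [hj4, show i ≠ 4 by omega] using (H.ne 0 (i + 1) (by omega) (by omega)).symm
    · simpa [hj4, show i ≠ 4 by omega] using H.ne (i + 1) (j + 1) (by omega) (by omega)
  · intro i hi
    by_cases hi4 : i = 4
    · simp only [hi4, if_true]
      exact rot (H.inc_l 0 (by omega)) (by omega)
    · simp only [hi4, if_false]
      have := H.l_mono (i := 1) (j := i + 1) (by omega) (by omega)
      exact rot (H.inc_l (i + 1) (by omega)) (by omega)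
  · intro i hi
    by_cases hi3 : i = 3
    · subst hi3
      exact rot H.inc_u (by simp; omega)
    · simp only [hi3, show i ≠ 4 by omega, if_false]
      have := H.h_mono (i := 1) (j := i + 1) (by omega) (by omega)
      exact rot (H.inc_h (i + 1) (by omega)) (by omega)
  · exact rot (H.inc_h 0 (by omega)) (by omega)

theorem IsRing.h_one_eq (H : IsRing 5 adj u l h c) (hr : 3 ≤ r)
    (hG : KuratowskiPlanar (augmentedGraph r adj)) : h 1 = l 3 := by
  obtain ⟨l', h', c', H', a1, a2, a3, a4, b0, b1, b2, b3⟩ := H.shift hr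
  have := H'.h_zero_eq hr (hG.rotate _)
  have h1 : l 2 < h 1 := H.l_lt_h 1 (by omega)
  have m12 : l 1 ≤ l 2 := H.l_mono (by omega) (by omega)
  have m13 : l 1 ≤ l 3 := H.l_mono (by omega) (by omega)
  omega

theorem IsRing.h_two_eq (H : IsRing 5 adj u l h c) (hr : 3 ≤ r)
    (hG : KuratowskiPlanar (augmentedGraph r adj)) : h 2 = l 4 := by
  obtain ⟨l', h', c', H', a1, a2, a3, a4, b0, b1, b2, b3⟩ := H.shift hr
  have := H'.h_one_eq hr (hG.rotate _)
  have h2 : l 3 < h 2 := H.l_lt_h 2 (by omega)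
  have m13 : l 1 ≤ l 3 := H.l_mono (by omega) (by omega)
  have m14 : l 1 ≤ l 4 := H.l_mono (by omega) (by omega)
  omega

theorem IsRing.h_three_eq (H : IsRing 5 adj u l h c) (hr : 3 ≤ r)
    (hG : KuratowskiPlanar (augmentedGraph r adj)) : h 3 = r := by
  obtain ⟨l', h', c', H', a1, a2, a3, a4, b0, b1, b2, b3⟩ := H.shift hr
  have := H'.h_two_eq hr (hG.rotate _)
  have h3 : l 4 < h 3 := H.l_lt_h 3 (by omega)
  have m14 : l 1 ≤ l 4 := H.l_mono (by omega) (by omega)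
  have e : h 3 ≤ r := H.h_le
  omega

theorem IsRing.u_eq (H : IsRing 5 adj u l h c) (hr : 3 ≤ r)
    (hG : KuratowskiPlanar (augmentedGraph r adj)) : u = l 1 := by
  obtain ⟨l', h', c', H', a1, a2, a3, a4, b0, b1, b2, b3⟩ := H.shift hr
  have := H'.h_three_eq hr (hG.rotate _)
  have h3 : l 4 < h 3 := H.l_lt_h 3 (by omega)
  have m14 : l 1 ≤ l 4 := H.l_mono (by omega) (by omega)
  have e : h 3 ≤ r := H.h_le
  omega

/-- A ring of length five forces a forbidden subdivision. -/
theorem IsRing.false_of_five (H : IsRing 5 adj u l h c) (hr : 3 ≤ r)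
    (hG : KuratowskiPlanar (augmentedGraph r adj)) : False := by
  have e0 := H.u_pos
  have e1 := H.u_le
  have e2 : l 1 < l 2 := H.l_lt_l 1 (by omega)
  have e3 : l 2 < l 3 := H.l_lt_l 2 (by omega)
  have e4 : l 3 < l 4 := H.l_lt_l 3 (by omega)
  have e5 : l 4 < h 3 := H.l_lt_h 3 (by omega)
  have e6 : h 3 ≤ r := H.h_le
  have f1 := H.h_zero_eq hr hG
  have f2 := H.h_one_eq hr hG
  have f3 := H.h_two_eq hr hG
  have f4 := H.h_three_eq hr hG
  have f5 := H.u_eq hr hG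
  have hu := H.inc_u
  have i0 := H.inc_h 0 (by omega)
  have i1 := H.inc_h 1 (by omega)
  have i2 := H.inc_h 2 (by omega)
  have i3 := H.inc_h 3 (by omega)
  rw [f1] at i0
  rw [f2] at i1
  rw [f3] at i2
  rw [f4] at i3
  rw [f5] at hu
  have j0 := H.inc_l 0 (by omega)
  rw [H.l_zero] at j0
  have hr0 : cycPos hr r = cycPos hr 0 := by simp [cycPos]
  have lt : ∀ {x y}, x < y → y < r → cycPos hr x < cycPos hr y := fun hxy hy => by
    rw [Fin.lt_def]
    simpa only [cycPos, Nat.mod_eq_of_lt hy, Nat.mod_eq_of_lt (hxy.trans hy)] using hxy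
  have j3 := i3.adj_cycPos hr
  rw [hr0] at j3
  exact hG.false_of_pentagram hr (a := cycPos hr 0) (b := cycPos hr (l 1)) (c := cycPos hr (l 2))
    (d := cycPos hr (l 3)) (e := cycPos hr (l 4)) (by simp [cycPos]) (lt (by omega) (by omega))
    (lt (by omega) (by omega)) (lt (by omega) (by omega)) (lt (by omega) (by omega))
    (H.ne 0 1 (by omega) (by omega)) (H.ne 0 2 (by omega) (by omega))
    (H.ne 0 3 (by omega) (by omega)) (H.ne 0 4 (by omega) (by omega))
    (H.ne 1 2 (by omega) (by omega)) (H.ne 1 3 (by omega) (by omega))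
    (H.ne 1 4 (by omega) (by omega)) (H.ne 2 3 (by omega) (by omega))
    (H.ne 2 4 (by omega) (by omega)) (H.ne 3 4 (by omega) (by omega))
    (j0.adj_cycPos hr) (i0.adj_cycPos hr) ((H.inc_l 1 (by omega)).adj_cycPos hr)
    (i1.adj_cycPos hr) ((H.inc_l 2 (by omega)).adj_cycPos hr) (i2.adj_cycPos hr)
    ((H.inc_l 3 (by omega)).adj_cycPos hr) j3 ((H.inc_l 4 (by omega)).adj_cycPos hr)
    (hu.adj_cycPos hr)

end ShortRing

/-- The mobile vertices, joined when their neighbor sets conflict. -/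
def conflictGraph {Vm : Type*} {r : ℕ} (adj : Fin r → Vm → Prop) : SimpleGraph Vm where
  Adj w w' := w ≠ w' ∧ Conflict {i | adj i w} {i | adj i w'}
  symm := ⟨fun _ _ h => ⟨h.1.symm, h.2.symm⟩⟩
  loopless := ⟨fun _ h => h.1 rfl⟩

theorem KuratowskiPlanar.colorable_conflictGraph {Vm : Type*} {r : ℕ} (hr : 3 ≤ r)
    {adj : Fin r → Vm → Prop} (hG : KuratowskiPlanar (augmentedGraph r adj)) :
    (conflictGraph adj).Colorable 2 := by
  by_contra hcol
  obtain ⟨n, c, ⟨hodd, hadj, hper⟩, hn, hne, hchord⟩ := exists_shortest_isOddLoop hcol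
  obtain ⟨m, hm⟩ := hodd
  by_cases hn3 : n = 3
  · subst hn3
    have h2 : (conflictGraph adj).Adj (c 2) (c 0) := by
      have := hadj 2
      rwa [show 2 + 1 = 0 + 3 by omega, hper] at this
    exact hG.false_of_three_conflicts hr (hadj 0).1 h2.1.symm (hadj 1).1 (hadj 1).2 (hadj 0).symm.2
      h2.symm.2
  have hS' : ∀ i j, i + 2 ≤ j → j + 2 ≤ i + n → ¬ Conflict {x | adj x (c i)} {x | adj x (c j)} :=
    fun i j hi hj h => hchord i j hi hj ⟨hne i j (by omega) (by omega), h⟩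
  obtain ⟨p, q, hpq, hper', hX⟩ := exists_crossing_chords (by omega)
    (S := fun i => {x | adj x (c i)}) (fun i => by simp only [hper]) (fun i => (hadj i).2) hS'
  obtain ⟨a, u, l, h, c', H⟩ := exists_isRing (by omega) (fun i => (hpq i).1) (fun i => (hpq i).2)
    hper' hne hX fun i j hi hj hc =>
      hS' i j hi hj ⟨_, (hpq i).1, _, (hpq i).2, _, (hpq j).1, _, (hpq j).2, hc⟩
  have hG' := hG.rotate a
  by_cases hn5 : n = 5
  · subst hn5
    exact H.false_of_five hr hG'
  · exact H.false_of_seven_le hr (by omega) ⟨m, hm⟩ hG'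

/-- Let `G = (V_f, V_m, E)` be a finite bipartite graph whose fixed vertices lie on a
horizontal line in the order `p_1, …, p_r` (`r ≥ 3`), and let `G'` be obtained from
`G` by adding a cycle through the fixed vertices in this order. If `G'` is
(Kuratowski) planar as an abstract graph, then there is an above/below assignment
`σ` of the mobile vertices such that the neighbor index sets of any two distinct
mobile vertices on the same side do not interleave. -/
theorem planar_augmented_graph_gives_two_page_assignment
    {Vm : Type*} [Fintype Vm] (r : ℕ) (hr : 3 ≤ r) (adj : Fin r → Vm → Prop)
    (hplanar : KuratowskiPlanar (augmentedGraph r adj)) :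
    ∃ σ : Vm → Bool, ∀ w w' : Vm, w ≠ w' → σ w = σ w' →
      ¬ Interleaves {i | adj i w} {i | adj i w'} := by
  obtain ⟨σ⟩ := hplanar.colorable_conflictGraph hr
  refine ⟨fun w => decide (σ w = 0), fun w w' hne heq hI => σ.valid ⟨hne, hI.conflict⟩ ?_⟩
  have := decide_eq_decide.1 heq
  omega
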